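/- arXiv:1410.3244 — 5 statements merged into one kernel-verified Lean document; each statement's English description precedes it below -/
import Mathlib

section
/- Let r ≥ 0 with r ≡ 0, 1, or 2 (mod 4) and let t₁, t₂, t₃ ≥ 0 be integers. Then every pseudo H-type Lie algebra n_{r+8t₁+4t₂, r+8t₃+4t₂} built on a minimal admissible Cl_{r+8t₁+4t₂, r+8t₃+4t₂}-module is isomorphic as a Lie algebra to every pseudo H-type Lie algebra n_{r+8t₃+4t₂, r+8t₁+4t₂} built on a minimal admissible Cl_{r+8t₃+4t₂, r+8t₁+4t₂}-module. -/
/-- The standard scalar product of signature `(r,s)` on `ℝ^(r+s)`: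
`⟨Z,W⟩_{r,s} = ∑_{i<r} Z i * W i - ∑_{r ≤ i < r+s} Z i * W i`. -/
def sform (r s : ℕ) (Z W : Fin (r + s) → ℝ) : ℝ :=
  ∑ i : Fin (r + s), (if (i : ℕ) < r then (1 : ℝ) else -1) * Z i * W i

/-- `(V, B, J)` is an admissible module of the Clifford algebra `Cl_{r,s}`:
`V` is a nonzero finite-dimensional real vector space, `B` a nondegenerate
symmetric bilinear form on `V`, and `J : ℝ^{r+s} → End V` linear with
`J_Z ∘ J_Z = -⟨Z,Z⟩_{r,s} • id` and each `J_Z` skew-adjoint w.r.t. `B`. -/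
def IsAdmissible (r s : ℕ) (V : Type) [AddCommGroup V] [Module ℝ V]
    (B : V →ₗ[ℝ] V →ₗ[ℝ] ℝ)
    (J : (Fin (r + s) → ℝ) →ₗ[ℝ] V →ₗ[ℝ] V) : Prop :=
  FiniteDimensional ℝ V ∧ Nontrivial V ∧
  (∀ v w : V, B v w = B w v) ∧
  (∀ v : V, (∀ w : V, B v w = 0) → v = 0) ∧
  (∀ (Z : Fin (r + s) → ℝ) (v : V), J Z (J Z v) = (-(sform r s Z Z)) • v) ∧
  (∀ (Z : Fin (r + s) → ℝ) (v w : V), B (J Z v) w = -(B v (J Z w)))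

/-- A minimal admissible `Cl_{r,s}`-module: one of least possible dimension. -/
def IsMinimalAdmissible (r s : ℕ) (V : Type) [AddCommGroup V] [Module ℝ V]
    (B : V →ₗ[ℝ] V →ₗ[ℝ] ℝ)
    (J : (Fin (r + s) → ℝ) →ₗ[ℝ] V →ₗ[ℝ] V) : Prop :=
  IsAdmissible r s V B J ∧
  ∀ (V' : Type) [AddCommGroup V'] [Module ℝ V']
    (B' : V' →ₗ[ℝ] V' →ₗ[ℝ] ℝ)
    (J' : (Fin (r + s) → ℝ) →ₗ[ℝ] V' →ₗ[ℝ] V'),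
    IsAdmissible r s V' B' J' → Module.finrank ℝ V ≤ Module.finrank ℝ V'

/-- `br` is the Lie bracket of the pseudo `H`-type Lie algebra `V ⊕ ℝ^{r+s}`
determined by the admissible module `(V,B,J)`, i.e.
`⟨Z, [v,w]⟩_{r,s} = ⟨J_Z v, w⟩_V` for all `Z, v, w`. -/
def IsHBracket (r s : ℕ) (V : Type) [AddCommGroup V] [Module ℝ V]
    (B : V →ₗ[ℝ] V →ₗ[ℝ] ℝ)
    (J : (Fin (r + s) → ℝ) →ₗ[ℝ] V →ₗ[ℝ] V)
    (br : V →ₗ[ℝ] V →ₗ[ℝ] (Fin (r + s) → ℝ)) : Prop :=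
  ∀ (Z : Fin (r + s) → ℝ) (v w : V), sform r s Z (br v w) = B (J Z v) w

/-- A linear equivalence `f` between the pseudo `H`-type Lie algebras
`V₁ ⊕ ℝ^{n₁}` and `V₂ ⊕ ℝ^{n₂}` (with 2-step brackets `br₁`, `br₂`, the
`ℝ^{nᵢ}` factors being central) is a Lie algebra isomorphism. -/
def IsLieIso {V₁ : Type} [AddCommGroup V₁] [Module ℝ V₁]
    {V₂ : Type} [AddCommGroup V₂] [Module ℝ V₂] {n₁ n₂ : ℕ}
    (br₁ : V₁ →ₗ[ℝ] V₁ →ₗ[ℝ] (Fin n₁ → ℝ))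
    (br₂ : V₂ →ₗ[ℝ] V₂ →ₗ[ℝ] (Fin n₂ → ℝ))
    (f : (V₁ × (Fin n₁ → ℝ)) ≃ₗ[ℝ] (V₂ × (Fin n₂ → ℝ))) : Prop :=
  ∀ x y : V₁ × (Fin n₁ → ℝ),
    f (0, br₁ x.1 y.1) = (0, br₂ (f x).1 (f y).1)

/-- The endomorphisms `J i`, `i ∈ s`, anticommute and square to `c i`, and `B` is a nondegenerate
form with `B x y = ε * B y x` for which every `J i` has adjoint `δ • J i`. -/
structure IsCliffordForm {ι : Type} (s : Finset ι) (c : ι → ℝ) (ε δ : ℝ)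
    {V : Type} [AddCommGroup V] [Module ℝ V]
    (J : ι → Module.End ℝ V) (B : V →ₗ[ℝ] V →ₗ[ℝ] ℝ) : Prop where
  sq : ∀ i ∈ s, ∀ v, J i (J i v) = c i • v
  anti : ∀ i ∈ s, ∀ j ∈ s, i ≠ j → ∀ v, J i (J j v) = -J j (J i v)
  symm : ∀ x y, B x y = ε * B y x
  adj : ∀ i ∈ s, ∀ x y, B (J i x) y = δ * B x (J i y)
  nondeg : ∀ x, (∀ y, B x y = 0) → x = 0

/-- There is no proper nonzero subspace that is invariant under the `J i`, `i ∈ s`, and on which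
`B` is nondegenerate. -/
def IsIndecomposable {ι : Type} (s : Finset ι) {V : Type} [AddCommGroup V] [Module ℝ V]
    (J : ι → Module.End ℝ V) (B : V →ₗ[ℝ] V →ₗ[ℝ] ℝ) : Prop :=
  ∀ W : Submodule ℝ V, (∀ i ∈ s, ∀ x ∈ W, J i x ∈ W) →
    (∀ x ∈ W, (∀ y ∈ W, B x y = 0) → x = 0) → W = ⊥ ∨ W = ⊤

/-- The sign `(-1) ^ (n * (n - 1) / 2)` of the reversal of `n` letters. -/
def revSign : ℕ → ℝ
  | 0 => 1
  | n + 1 => (-1) ^ n * revSign n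

/-- The symmetry sign of the form obtained by splitting off `m` hyperbolic pairs of generators
from a form with signs `(ε, δ)`. -/
def coreSign : ℕ → ℝ → ℝ → ℝ
  | 0, ε, _ => ε
  | m + 1, ε, δ => coreSign m (ε * δ) (-δ)

theorem coreSign_eq_neg_one (k : ℕ) : coreSign (4 * k + 1) 1 (-1) = -1 := by
  induction k with
  | zero => simp [coreSign]
  | succ k ih =>
    have : 4 * (k + 1) + 1 = (4 * k + 1) + 1 + 1 + 1 + 1 := by ring
    rw [this]
    simpa [coreSign] using ih

theorem revSign_mul_self (n : ℕ) : revSign n * revSign n = 1 := by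
  induction n with
  | zero => simp [revSign]
  | succ n ih =>
    have h : ((-1 : ℝ) ^ n) * (-1) ^ n = 1 := by rw [← mul_pow]; simp
    simp only [revSign]
    linear_combination h * (revSign n * revSign n) + ih

theorem revSign_two_mul (m : ℕ) : revSign (2 * m) = (-1) ^ m := by
  induction m with
  | zero => simp [revSign]
  | succ m ih =>
    have : 2 * (m + 1) = 2 * m + 1 + 1 := by ring
    rw [this]
    simp [revSign, ih, pow_succ, pow_mul]

section Words

variable {ι : Type} {s : Finset ι} {c : ι → ℝ} {ε δ : ℝ}
  {V : Type} [AddCommGroup V] [Module ℝ V]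
  {J : ι → Module.End ℝ V} {B : V →ₗ[ℝ] V →ₗ[ℝ] ℝ}

theorem IsCliffordForm.word_of_notMem (H : IsCliffordForm s c ε δ J B) {k : ι} (hk : k ∈ s)
    (l : List ι) (hl : ∀ i ∈ l, i ∈ s) (hkl : k ∉ l) (v : V) :
    J k ((l.map J).prod v) = (-1 : ℝ) ^ l.length • (l.map J).prod (J k v) := by
  induction l with
  | nil => simp
  | cons x l ih =>
    simp only [List.mem_cons, not_or, forall_eq_or_imp] at hl hkl
    simp only [List.map_cons, List.prod_cons, Module.End.mul_apply, List.length_cons]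
    rw [H.anti k hk x hl.1 hkl.1, ih hl.2 hkl.2, map_smul, pow_succ]
    simp

theorem IsCliffordForm.word_of_mem (H : IsCliffordForm s c ε δ J B) {k : ι}
    (l : List ι) (hl : ∀ i ∈ l, i ∈ s) (hnd : l.Nodup) (hkl : k ∈ l) (v : V) :
    J k ((l.map J).prod v) = (-1 : ℝ) ^ (l.length + 1) • (l.map J).prod (J k v) := by
  induction l with
  | nil => simp at hkl
  | cons x l ih =>
    have hk := hl k hkl
    simp only [List.mem_cons, forall_eq_or_imp, List.nodup_cons] at hl hkl hnd
    simp only [List.map_cons, List.prod_cons, Module.End.mul_apply, List.length_cons]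
    by_cases hx : k = x
    · subst hx
      rw [H.word_of_notMem hk l hl.2 hnd.1, map_smul, pow_succ, pow_succ]
      simp
    · rw [H.anti k hk x hl.1 hx, ih hl.2 hnd.2 (hkl.resolve_left hx), map_smul, pow_succ _ (_ + 1)]
      simp

theorem IsCliffordForm.word_sq (H : IsCliffordForm s c ε δ J B)
    (l : List ι) (hl : ∀ i ∈ l, i ∈ s) (hnd : l.Nodup) (v : V) :
    (l.map J).prod ((l.map J).prod v) = ((l.map c).prod * revSign l.length) • v := by
  induction l generalizing v with
  | nil => simp [revSign]
  | cons x l ih =>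
    simp only [List.mem_cons, forall_eq_or_imp, List.nodup_cons] at hl hnd
    simp only [List.map_cons, List.prod_cons, Module.End.mul_apply, List.length_cons, revSign]
    have h := H.word_of_notMem hl.1 l hl.2 hnd.1 ((l.map J).prod v)
    have h2 : (l.map J).prod (J x ((l.map J).prod v))
        = (-1 : ℝ) ^ l.length • J x ((l.map J).prod ((l.map J).prod v)) := by
      rw [h, smul_smul, ← mul_pow]; simp
    rw [h2, map_smul, H.sq x hl.1, ih hl.2 hnd.2, smul_smul, smul_smul]
    congr 1; ring

theorem IsCliffordForm.word_adj (H : IsCliffordForm s c ε δ J B)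
    (l : List ι) (hl : ∀ i ∈ l, i ∈ s) (hnd : l.Nodup) (v w : V) :
    B ((l.map J).prod v) w = (δ ^ l.length * revSign l.length) * B v ((l.map J).prod w) := by
  induction l generalizing w with
  | nil => simp [revSign]
  | cons x l ih =>
    simp only [List.mem_cons, forall_eq_or_imp, List.nodup_cons] at hl hnd
    simp only [List.map_cons, List.prod_cons, Module.End.mul_apply, List.length_cons, revSign]
    rw [H.adj x hl.1, ih hl.2 hnd.2, H.word_of_notMem hl.1 l hl.2 hnd.1, map_smul, smul_eq_mul]
    have h : ((-1 : ℝ) ^ l.length) * (-1) ^ l.length = 1 := by rw [← mul_pow]; simp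
    linear_combination (-(δ * δ ^ l.length * revSign l.length *
      B v ((l.map J).prod (J x w)))) * h

theorem word_mem {W : Submodule ℝ V} (l : List ι) (h : ∀ i ∈ l, ∀ x ∈ W, J i x ∈ W) :
    ∀ x ∈ W, (l.map J).prod x ∈ W := by
  induction l with
  | nil => simp
  | cons k l ih =>
    simp only [List.mem_cons, forall_eq_or_imp] at h
    intro x hx
    exact h.1 _ (ih h.2 x hx)

theorem word_equivariant {V' : Type} [AddCommGroup V'] [Module ℝ V']
    {J' : ι → Module.End ℝ V'} (φ : V →ₗ[ℝ] V') (l : List ι)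
    (h : ∀ i ∈ l, ∀ x, φ (J i x) = J' i (φ x)) (x : V) :
    φ ((l.map J).prod x) = (l.map J').prod (φ x) := by
  induction l with
  | nil => simp
  | cons k l ih =>
    simp only [List.mem_cons, forall_eq_or_imp] at h
    simp [h.1, ih h.2]

theorem word_twist {M : Module.End ℝ V} {J' : ι → Module.End ℝ V}
    (l : List ι) (hJ' : ∀ i ∈ l, ∀ v, J' i v = M (J i v))
    (hanti : ∀ i ∈ l, ∀ v, J i (M v) = -M (J i v)) :
    ∀ v, (l.map J').prod v = revSign l.length • (M ^ l.length) ((l.map J).prod v) := by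
  have hpow : ∀ i ∈ l, ∀ (n : ℕ) v, J i ((M ^ n) v) = (-1 : ℝ) ^ n • (M ^ n) (J i v) := by
    intro i hi n
    induction n with
    | zero => simp
    | succ n ih =>
      intro v
      rw [pow_succ', Module.End.mul_apply, hanti i hi, ih, pow_succ (-1 : ℝ)]
      simp
  induction l with
  | nil => simp [revSign]
  | cons k l ih =>
    intro v
    have ih' := ih (fun i hi => hJ' i (by simp [hi])) (fun i hi => hanti i (by simp [hi]))
      (fun i hi => hpow i (by simp [hi])) v
    simp only [List.map_cons, List.prod_cons, Module.End.mul_apply, List.length_cons, revSign]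
    rw [ih', hJ' k (by simp), map_smul, hpow k (by simp), pow_succ', Module.End.mul_apply]
    simp [smul_smul, mul_comm]

theorem word_twist_even {M : Module.End ℝ V} {J' : ι → Module.End ℝ V} (hM : ∀ v, M (M v) = v)
    (l : List ι) (heven : Even l.length) (hJ' : ∀ i ∈ l, ∀ v, J' i v = M (J i v))
    (hanti : ∀ i ∈ l, ∀ v, J i (M v) = -M (J i v)) (v : V) :
    (l.map J).prod v = revSign l.length • (l.map J').prod v := by
  have h2 : M ^ 2 = 1 := by ext v; simp [pow_two, hM]
  obtain ⟨m, hm⟩ := heven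
  have h : M ^ l.length = 1 := by rw [hm, ← two_mul, pow_mul, h2, one_pow]
  rw [word_twist l hJ' hanti, h, smul_smul, revSign_mul_self]
  simp

end Words

section Splitting

variable {ι : Type} {V : Type} [AddCommGroup V] [Module ℝ V]

/-- The `1`-eigenspace of `J a * J b`. -/
def core (J : ι → Module.End ℝ V) (a b : ι) : Submodule ℝ V :=
  LinearMap.eqLocus (J a * J b) LinearMap.id

theorem mem_core {J : ι → Module.End ℝ V} {a b : ι} {v : V} :
    v ∈ core J a b ↔ J a (J b v) = v := Iff.rfl

/-- The endomorphisms `J i`, `i ∈ s`, anticommute and square to `c i`, and `a`, `b` are two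
indices in `s` with `c a = -1` and `c b = 1`. -/
structure IsHyperbolicPair (s : Finset ι) (c : ι → ℝ) (J : ι → Module.End ℝ V) (a b : ι) :
    Prop where
  sq : ∀ i ∈ s, ∀ v, J i (J i v) = c i • v
  anti : ∀ i ∈ s, ∀ j ∈ s, i ≠ j → ∀ v, J i (J j v) = -J j (J i v)
  ma : a ∈ s
  mb : b ∈ s
  ca : c a = -1
  cb : c b = 1

namespace IsHyperbolicPair

variable {s : Finset ι} {c : ι → ℝ} {J : ι → Module.End ℝ V} {a b : ι}

theorem ne (H : IsHyperbolicPair s c J a b) : a ≠ b := by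
  rintro rfl
  have := H.ca.symm.trans H.cb
  norm_num at this

theorem aa (H : IsHyperbolicPair s c J a b) (v : V) : J a (J a v) = -v := by
  rw [H.sq a H.ma, H.ca]; simp

theorem bb (H : IsHyperbolicPair s c J a b) (v : V) : J b (J b v) = v := by
  rw [H.sq b H.mb, H.cb]; simp

theorem ba (H : IsHyperbolicPair s c J a b) (v : V) : J b (J a v) = -J a (J b v) :=
  H.anti b H.mb a H.ma H.ne.symm v

/-- The projection onto the core. -/
noncomputable def proj (H : IsHyperbolicPair s c J a b) : V →ₗ[ℝ] core J a b :=
  LinearMap.codRestrict _ ((1 / 2 : ℝ) • (LinearMap.id + J a * J b)) (by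
    intro v
    simp [mem_core, H.aa, H.bb, H.ba, add_comm])

theorem coe_proj (H : IsHyperbolicPair s c J a b) (v : V) :
    (H.proj v : V) = (1 / 2 : ℝ) • (v + J a (J b v)) := rfl

theorem proj_coe (H : IsHyperbolicPair s c J a b) (x : core J a b) : H.proj (x : V) = x := by
  ext
  rw [coe_proj, mem_core.1 x.2, ← two_smul ℝ, smul_smul]
  simp

theorem proj_a_coe (H : IsHyperbolicPair s c J a b) (x : core J a b) :
    H.proj (J a (x : V)) = 0 := by
  ext
  rw [coe_proj, H.ba, map_neg, mem_core.1 x.2]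
  simp

theorem proj_aa (H : IsHyperbolicPair s c J a b) (v : V) :
    H.proj (J a (J a v)) = -H.proj v := by rw [H.aa, map_neg]

theorem proj_b (H : IsHyperbolicPair s c J a b) (v : V) :
    H.proj (J b v) = H.proj (J a v) := by
  ext
  rw [coe_proj, coe_proj, H.ba, map_neg, H.aa, H.bb, neg_neg, add_comm]

theorem proj_ab (H : IsHyperbolicPair s c J a b) (v : V) :
    H.proj (J a (J b v)) = H.proj v := by
  rw [← neg_neg (J a (J b v)), ← H.ba, map_neg, H.proj_b, H.proj_aa, neg_neg]

theorem decomp (H : IsHyperbolicPair s c J a b) (v : V) :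
    v = H.proj v - J a (H.proj (J a v)) := by
  rw [coe_proj, coe_proj, H.ba]
  simp only [map_smul, map_add, map_neg, H.aa]
  module

/-- The operators induced on the core. -/
noncomputable def coreOp (H : IsHyperbolicPair s c J a b) (i : ι) : Module.End ℝ (core J a b) :=
  H.proj ∘ₗ J i ∘ₗ (core J a b).subtype

theorem coe_coreOp [DecidableEq ι] (H : IsHyperbolicPair s c J a b) {i : ι}
    (hi : i ∈ (s.erase a).erase b) (x : core J a b) : (H.coreOp i x : V) = J i x := by
  simp only [Finset.mem_erase] at hi
  obtain ⟨hb, ha, hs⟩ := hi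
  have hm : J i (x : V) ∈ core J a b := by
    rw [mem_core, H.anti b H.mb i hs (Ne.symm hb), map_neg, H.anti a H.ma i hs (Ne.symm ha),
      mem_core.1 x.2, neg_neg]
  exact congrArg Subtype.val (H.proj_coe ⟨_, hm⟩)

theorem proj_op [DecidableEq ι] (H : IsHyperbolicPair s c J a b) {i : ι}
    (hi : i ∈ (s.erase a).erase b) (v : V) :
    H.proj (J i v) = H.coreOp i (H.proj v) := by
  ext
  rw [H.coe_coreOp hi, coe_proj, coe_proj]
  simp only [Finset.mem_erase] at hi
  obtain ⟨hb, ha, hs⟩ := hi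
  rw [map_smul, map_add, H.anti i hs a H.ma ha, H.anti i hs b H.mb hb, map_neg, neg_neg]

theorem proj_a_op [DecidableEq ι] (H : IsHyperbolicPair s c J a b) {i : ι}
    (hi : i ∈ (s.erase a).erase b) (v : V) : H.proj (J a (J i v)) = -H.coreOp i (H.proj (J a v)) := by
  rw [← H.proj_op hi, ← map_neg]
  simp only [Finset.mem_erase] at hi
  rw [H.anti a H.ma i hi.2.2 (Ne.symm hi.2.1)]

variable {V' : Type} [AddCommGroup V'] [Module ℝ V'] {J' : ι → Module.End ℝ V'}

/-- The equivariant extension of a map between cores. -/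
noncomputable def extend (H : IsHyperbolicPair s c J a b)
    (φ : core J a b →ₗ[ℝ] core J' a b) : V →ₗ[ℝ] V' :=
  (core J' a b).subtype ∘ₗ φ ∘ₗ H.proj - J' a ∘ₗ (core J' a b).subtype ∘ₗ φ ∘ₗ H.proj ∘ₗ J a

theorem extend_apply (H : IsHyperbolicPair s c J a b)
    (φ : core J a b →ₗ[ℝ] core J' a b) (v : V) :
    H.extend φ v = φ (H.proj v) - J' a (φ (H.proj (J a v))) := rfl

theorem proj_extend (H : IsHyperbolicPair s c J a b) (H' : IsHyperbolicPair s c J' a b)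
    (φ : core J a b →ₗ[ℝ] core J' a b) (v : V) :
    H'.proj (H.extend φ v) = φ (H.proj v) := by
  rw [extend_apply, map_sub, proj_coe, proj_a_coe, sub_zero]

theorem proj_a_extend (H : IsHyperbolicPair s c J a b) (H' : IsHyperbolicPair s c J' a b)
    (φ : core J a b →ₗ[ℝ] core J' a b) (v : V) :
    H'.proj (J' a (H.extend φ v)) = φ (H.proj (J a v)) := by
  rw [extend_apply, map_sub, map_sub, proj_a_coe, proj_aa, proj_coe, zero_sub, neg_neg]

theorem ext_proj (H : IsHyperbolicPair s c J a b) {v w : V} (h : H.proj v = H.proj w)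
    (h' : H.proj (J a v) = H.proj (J a w)) : v = w := by
  rw [H.decomp v, H.decomp w, h, h']

theorem extend_equivariant [DecidableEq ι] (H : IsHyperbolicPair s c J a b)
    (H' : IsHyperbolicPair s c J' a b) (φ : core J a b →ₗ[ℝ] core J' a b)
    (hφ : ∀ i ∈ (s.erase a).erase b, ∀ x, φ (H.coreOp i x) = H'.coreOp i (φ x)) :
    ∀ i ∈ s, ∀ v, H.extend φ (J i v) = J' i (H.extend φ v) := by
  intro i hi v
  apply H'.ext_proj
  · rw [proj_extend]
    by_cases ha : i = a
    · subst ha; rw [proj_a_extend]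
    by_cases hb : i = b
    · subst hb; rw [H.proj_b, H'.proj_b, proj_a_extend]
    have hm : i ∈ (s.erase a).erase b := by simp [ha, hb, hi]
    rw [H.proj_op hm, H'.proj_op hm, proj_extend, hφ i hm]
  · rw [proj_a_extend]
    by_cases ha : i = a
    · subst ha; rw [H.proj_aa, H'.proj_aa, proj_extend, map_neg]
    by_cases hb : i = b
    · subst hb; rw [H.proj_ab, H'.proj_ab, proj_extend]
    have hm : i ∈ (s.erase a).erase b := by simp [ha, hb, hi]
    rw [H.proj_a_op hm, H'.proj_a_op hm, proj_a_extend, map_neg, hφ i hm]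

end IsHyperbolicPair

/-- The form induced on the core. -/
noncomputable def coreForm (J : ι → Module.End ℝ V) (a b : ι) (B : V →ₗ[ℝ] V →ₗ[ℝ] ℝ) :
    core J a b →ₗ[ℝ] core J a b →ₗ[ℝ] ℝ :=
  B.compl₁₂ (core J a b).subtype (J a ∘ₗ (core J a b).subtype)

theorem coreForm_apply (J : ι → Module.End ℝ V) (a b : ι) (B : V →ₗ[ℝ] V →ₗ[ℝ] ℝ)
    (x y : core J a b) : coreForm J a b B x y = B x (J a y) := rfl

namespace IsCliffordForm

variable {s : Finset ι} {c : ι → ℝ} {ε δ : ℝ} {J : ι → Module.End ℝ V}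
  {B : V →ₗ[ℝ] V →ₗ[ℝ] ℝ} {a b : ι}

theorem isHyperbolicPair (H : IsCliffordForm s c ε δ J B) (ma : a ∈ s) (mb : b ∈ s)
    (ca : c a = -1) (cb : c b = 1) : IsHyperbolicPair s c J a b :=
  ⟨H.sq, H.anti, ma, mb, ca, cb⟩

theorem form_core (H : IsCliffordForm s c ε δ J B) (hδ : δ * δ = 1)
    (P : IsHyperbolicPair s c J a b) (x y : core J a b) : B (x : V) (y : V) = 0 := by
  have h1 : B (x : V) (y : V) = B (J a (J b x)) y := by rw [mem_core.1 x.2]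
  rw [H.adj a P.ma, H.adj b P.mb, P.ba, mem_core.1 y.2, map_neg] at h1
  linear_combination (1 / 2 : ℝ) * h1 - (1 / 2 : ℝ) * hδ * B (x : V) (y : V)

theorem form_eq (H : IsCliffordForm s c ε δ J B) (hδ : δ * δ = 1)
    (P : IsHyperbolicPair s c J a b) (v w : V) :
    B v w = -(coreForm J a b B (P.proj v) (P.proj (J a w))
      + δ * coreForm J a b B (P.proj (J a v)) (P.proj w)) := by
  conv_lhs => rw [P.decomp v, P.decomp w]
  simp only [map_sub, LinearMap.sub_apply, coreForm_apply]
  rw [H.form_core hδ P, H.adj a P.ma, H.adj a P.ma, P.aa, map_neg, H.form_core hδ P]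
  ring

theorem coreForm [DecidableEq ι] (H : IsCliffordForm s c ε δ J B) (hδ : δ * δ = 1)
    (P : IsHyperbolicPair s c J a b) :
    IsCliffordForm ((s.erase a).erase b) c (ε * δ) (-δ) P.coreOp (coreForm J a b B) where
  sq i hi x := by
    ext
    rw [P.coe_coreOp hi, P.coe_coreOp hi, H.sq i (by simp_all)]
    rfl
  anti i hi j hj hij x := by
    ext
    rw [P.coe_coreOp hi, P.coe_coreOp hj, Submodule.coe_neg, P.coe_coreOp hj, P.coe_coreOp hi,
      H.anti i (by simp_all) j (by simp_all) hij]
  symm x y := by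
    rw [coreForm_apply, coreForm_apply, H.symm, H.adj a P.ma]
    ring
  adj i hi x y := by
    rw [coreForm_apply, coreForm_apply, P.coe_coreOp hi, P.coe_coreOp hi]
    simp only [Finset.mem_erase] at hi
    rw [H.adj i hi.2.2, H.anti i hi.2.2 a P.ma hi.2.1, map_neg]
    ring
  nondeg x hx := by
    ext
    refine H.nondeg _ fun w => ?_
    rw [H.form_eq hδ P, P.proj_coe, P.proj_a_coe, hx]
    simp

theorem indecomposable_core [DecidableEq ι] (H : IsCliffordForm s c ε δ J B) (hδ : δ * δ = 1)
    (P : IsHyperbolicPair s c J a b) (hI : IsIndecomposable s J B) :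
    IsIndecomposable ((s.erase a).erase b) P.coreOp (_root_.coreForm J a b B) := by
  intro W hW hnd
  have hδ0 : δ ≠ 0 := by rintro rfl; simp at hδ
  let W' : Submodule ℝ V := W.comap P.proj ⊓ W.comap (P.proj ∘ₗ J a)
  have mW' : ∀ v, v ∈ W' ↔ P.proj v ∈ W ∧ P.proj (J a v) ∈ W := fun v => Iff.rfl
  have hsub : ∀ x ∈ W, (x : V) ∈ W' := fun x hx => by
    rw [mW', P.proj_coe, P.proj_a_coe]; exact ⟨hx, W.zero_mem⟩
  have hsub' : ∀ x ∈ W, J a (x : V) ∈ W' := fun x hx => by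
    rw [mW', P.proj_a_coe, P.proj_aa, P.proj_coe]; exact ⟨W.zero_mem, W.neg_mem hx⟩
  have hinv : ∀ i ∈ s, ∀ x ∈ W', J i x ∈ W' := by
    intro i hi v hv
    rw [mW'] at hv ⊢
    by_cases ha : i = a
    · subst ha; rw [P.proj_aa]; exact ⟨hv.2, W.neg_mem hv.1⟩
    by_cases hb : i = b
    · subst hb; rw [P.proj_b, P.proj_ab]; exact ⟨hv.2, hv.1⟩
    have hm : i ∈ (s.erase a).erase b := by simp [ha, hb, hi]
    rw [P.proj_op hm, P.proj_a_op hm]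
    exact ⟨hW i hm _ hv.1, W.neg_mem (hW i hm _ hv.2)⟩
  have hnondeg : ∀ x ∈ W', (∀ y ∈ W', B x y = 0) → x = 0 := by
    intro v hv hv0
    rw [mW'] at hv
    apply P.ext_proj
    · rw [map_zero]
      refine hnd _ hv.1 fun y hy => ?_
      have := hv0 _ (hsub' y hy)
      rw [H.form_eq hδ P, P.proj_a_coe, P.proj_aa, P.proj_coe] at this
      simpa using this
    · rw [map_zero, map_zero]
      refine hnd _ hv.2 fun y hy => ?_
      have := hv0 _ (hsub y hy)
      rw [H.form_eq hδ P, P.proj_a_coe, P.proj_coe] at this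
      simpa [hδ0] using this
  rcases hI W' hinv hnondeg with h | h
  · left
    rw [eq_bot_iff]
    intro x hx
    have := hsub x hx
    rw [h, Submodule.mem_bot] at this
    simpa using this
  · right
    rw [eq_top_iff]
    intro x _
    have : (x : V) ∈ W' := by rw [h]; trivial
    simpa [P.proj_coe] using ((mW' _).1 this).1

end IsCliffordForm

end Splitting

section Twist

variable {ι : Type} {s : Finset ι} {c : ι → ℝ} {ε δ : ℝ}
  {V : Type} [AddCommGroup V] [Module ℝ V] {J : ι → Module.End ℝ V} {B : V →ₗ[ℝ] V →ₗ[ℝ] ℝ}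

/-- Multiply each `J i`, `i ∈ t`, by the product of all the `J j`, `j ∈ t`. -/
def twist [DecidableEq ι] (t : List ι) (J : ι → Module.End ℝ V) (i : ι) : Module.End ℝ V :=
  if i ∈ t then (t.map J).prod * J i else J i

/-- Change the signs `c i` for `i ∈ t`. -/
def flipSign [DecidableEq ι] (t : List ι) (c : ι → ℝ) (i : ι) : ℝ := if i ∈ t then -c i else c i

/-- The index lists `t` for which twisting by `t` preserves admissibility. -/
structure IsTwistable (s : Finset ι) (c : ι → ℝ) (t : List ι) : Prop where
  nodup : t.Nodup
  subset : ∀ i ∈ t, i ∈ s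
  even : Even t.length
  sq : (t.map c).prod * revSign t.length = 1

namespace IsCliffordForm

variable {t : List ι}

theorem twist_sq (H : IsCliffordForm s c ε δ J B) (T : IsTwistable s c t) (v : V) :
    (t.map J).prod ((t.map J).prod v) = v := by
  rw [H.word_sq t T.subset T.nodup, T.sq, one_smul]

theorem twist_anti (H : IsCliffordForm s c ε δ J B) (T : IsTwistable s c t) {i : ι} (hi : i ∈ t)
    (v : V) : J i ((t.map J).prod v) = -(t.map J).prod (J i v) := by
  rw [H.word_of_mem t T.subset T.nodup hi, pow_succ, T.even.neg_one_pow]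
  simp

theorem twist_comm (H : IsCliffordForm s c ε δ J B) (T : IsTwistable s c t) {i : ι} (hs : i ∈ s)
    (hi : i ∉ t) (v : V) : J i ((t.map J).prod v) = (t.map J).prod (J i v) := by
  rw [H.word_of_notMem hs t T.subset hi, T.even.neg_one_pow, one_smul]

variable [DecidableEq ι]

theorem twist_word (H : IsCliffordForm s c ε δ J B) (T : IsTwistable s c t) (v : V) :
    (t.map J).prod v = revSign t.length • (t.map (twist t J)).prod v :=
  word_twist_even (H.twist_sq T) t T.even (fun i hi v => by simp [twist, hi])
    (fun _ hi => H.twist_anti T hi) v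

theorem twist_of_twist (H : IsCliffordForm s c ε δ J B) (T : IsTwistable s c t) (i : ι) (v : V) :
    J i v = if i ∈ t then (t.map J).prod (twist t J i v) else twist t J i v := by
  split_ifs with h
  · simp [twist, h, H.twist_sq T]
  · simp [twist, h]

theorem twist_square (H : IsCliffordForm s c ε δ J B) (T : IsTwistable s c t) {i : ι}
    (hi : i ∈ s) (v : V) : twist t J i (twist t J i v) = flipSign t c i • v := by
  by_cases h : i ∈ t
  · simp [twist, flipSign, h, H.twist_anti T h, H.twist_sq T, H.sq i hi]
  · simp [twist, flipSign, h, H.sq i hi]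

theorem twist_anticomm (H : IsCliffordForm s c ε δ J B) (T : IsTwistable s c t) {i j : ι}
    (hi : i ∈ s) (hj : j ∈ s) (hij : i ≠ j) (v : V) :
    twist t J i (twist t J j v) = -twist t J j (twist t J i v) := by
  by_cases h : i ∈ t <;> by_cases h' : j ∈ t <;>
  simp [twist, h, h', H.twist_anti T, H.twist_comm T, H.twist_sq T, hi, hj, H.anti i hi j hj hij]

theorem twist (H : IsCliffordForm s c ε δ J B) (T : IsTwistable s c t)
    (hadj : δ ^ t.length * revSign t.length = 1) :
    IsCliffordForm s (flipSign t c) ε δ (twist t J) (B ∘ₗ (t.map J).prod) where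
  sq _ hi := H.twist_square T hi
  anti _ hi _ hj hij := H.twist_anticomm T hi hj hij
  symm x y := by
    rw [LinearMap.comp_apply, LinearMap.comp_apply, H.word_adj t T.subset T.nodup, hadj, H.symm]
    ring
  adj i hi x y := by
    simp only [LinearMap.comp_apply]
    by_cases h : i ∈ t
    · simp only [_root_.twist, h, if_true, Module.End.mul_apply]
      rw [H.twist_sq T, H.word_adj t T.subset T.nodup, hadj, H.twist_sq T, H.adj i hi]
      ring
    · simp only [_root_.twist, h, if_false]
      rw [← H.twist_comm T hi h, H.adj i hi]
  nondeg x hx := by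
    have : (t.map J).prod x = 0 := H.nondeg _ hx
    rw [← H.twist_sq T x, this, map_zero]

theorem mem_of_twist (H : IsCliffordForm s c ε δ J B) (T : IsTwistable s c t)
    {W : Submodule ℝ V} (hW : ∀ i ∈ s, ∀ x ∈ W, _root_.twist t J i x ∈ W) :
    (∀ x ∈ W, (t.map J).prod x ∈ W) ∧ ∀ i ∈ s, ∀ x ∈ W, J i x ∈ W := by
  have h : ∀ x ∈ W, (t.map J).prod x ∈ W := fun x hx => by
    rw [H.twist_word T]
    exact W.smul_mem _ (word_mem t (fun i hi => hW i (T.subset i hi)) x hx)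
  refine ⟨h, fun i hi x hx => ?_⟩
  rw [H.twist_of_twist T]
  split_ifs
  · exact h _ (hW i hi x hx)
  · exact hW i hi x hx

theorem equivariant_of_twist (H : IsCliffordForm s c ε δ J B) (T : IsTwistable s c t)
    {V' : Type} [AddCommGroup V'] [Module ℝ V'] {J' : ι → Module.End ℝ V'}
    {B' : V' →ₗ[ℝ] V' →ₗ[ℝ] ℝ} {ε' δ' : ℝ} (H' : IsCliffordForm s c ε' δ' J' B')
    {φ : V →ₗ[ℝ] V'} (hφ : ∀ i ∈ s, ∀ x, φ (_root_.twist t J i x) = _root_.twist t J' i (φ x)) :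
    (∀ x, φ ((t.map J).prod x) = (t.map J').prod (φ x)) ∧
      ∀ i ∈ s, ∀ x, φ (J i x) = J' i (φ x) := by
  have h : ∀ x, φ ((t.map J).prod x) = (t.map J').prod (φ x) := fun x => by
    rw [H.twist_word T, H'.twist_word T, map_smul,
      word_equivariant φ t fun i hi => hφ i (T.subset i hi)]
  refine ⟨h, fun i hi x => ?_⟩
  rw [H.twist_of_twist T, H'.twist_of_twist T]
  split_ifs
  · rw [h, hφ i hi]
  · exact hφ i hi x

theorem indecomposable_twist (H : IsCliffordForm s c ε δ J B) (T : IsTwistable s c t)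
    (hI : IsIndecomposable s J B) :
    IsIndecomposable s (_root_.twist t J) (B ∘ₗ (t.map J).prod) := by
  intro W hW hnd
  obtain ⟨h, h'⟩ := H.mem_of_twist T hW
  refine hI W h' fun x hx hx0 => ?_
  have : (t.map J).prod x = 0 := hnd _ (h x hx) fun y hy => by
    rw [LinearMap.comp_apply, H.twist_sq T]
    exact hx0 y hy
  rw [← H.twist_sq T x, this, map_zero]

end IsCliffordForm

end Twist

section Uniqueness

variable {ι : Type} {s : Finset ι} {c : ι → ℝ}

/-- `φ` is a similarity of Clifford modules with forms. -/
def IsSimilarity (s : Finset ι) {V V' : Type} [AddCommGroup V] [Module ℝ V] [AddCommGroup V']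
    [Module ℝ V'] (J : ι → Module.End ℝ V) (B : V →ₗ[ℝ] V →ₗ[ℝ] ℝ)
    (J' : ι → Module.End ℝ V') (B' : V' →ₗ[ℝ] V' →ₗ[ℝ] ℝ) (φ : V →ₗ[ℝ] V') : Prop :=
  (∀ i ∈ s, ∀ x, φ (J i x) = J' i (φ x)) ∧ ∃ r : ℝ, r ≠ 0 ∧ ∀ x y, B' (φ x) (φ y) = r * B x y

/-- `π` is an equivariant projection whose image and kernel are totally isotropic. -/
structure IsPolarization (s : Finset ι) {V : Type} [AddCommGroup V] [Module ℝ V]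
    (J : ι → Module.End ℝ V) (B : V →ₗ[ℝ] V →ₗ[ℝ] ℝ) (π : V →ₗ[ℝ] V) : Prop where
  comm : ∀ i ∈ s, ∀ x, π (J i x) = J i (π x)
  idem : ∀ x, π (π x) = π x
  adj : ∀ x y, B (π x) y = B x (y - π y)

/-- Indecomposable forms with the given generators are unique up to similarity, and those with
skew-symmetric core have a polarization. -/
def HasUniqueForms (s : Finset ι) (c : ι → ℝ) : Prop :=
  ∀ ε δ : ℝ, (ε = 1 ∨ ε = -1) → (δ = 1 ∨ δ = -1) →
  ∀ (V V' : Type) [AddCommGroup V] [Module ℝ V] [AddCommGroup V'] [Module ℝ V']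
    (J : ι → Module.End ℝ V) (B : V →ₗ[ℝ] V →ₗ[ℝ] ℝ)
    (J' : ι → Module.End ℝ V') (B' : V' →ₗ[ℝ] V' →ₗ[ℝ] ℝ),
    Nontrivial V → Nontrivial V' → IsCliffordForm s c ε δ J B → IsCliffordForm s c ε δ J' B' →
    IsIndecomposable s J B → IsIndecomposable s J' B' →
    (∃ φ : V →ₗ[ℝ] V', IsSimilarity s J B J' B' φ) ∧
      (coreSign (s.card / 2) ε δ = -1 → ∃ π : V →ₗ[ℝ] V, IsPolarization s J B π)

theorem hasUniqueForms_of_flipSign [DecidableEq ι] {t : List ι} (T : IsTwistable s c t)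
    (h1 : revSign t.length = 1) (h : HasUniqueForms s (flipSign t c)) : HasUniqueForms s c := by
  intro ε δ hε hδ V V' _ _ _ _ J B J' B' _ _ H H' I I'
  have hadj : δ ^ t.length * revSign t.length = 1 := by
    rcases hδ with rfl | rfl <;> simp [h1, T.even.neg_one_pow]
  obtain ⟨⟨φ, hφ, r, hr, hB⟩, hpol⟩ := h ε δ hε hδ V V' _ _ _ _ ‹_› ‹_› (H.twist T hadj)
    (H'.twist T hadj) (H.indecomposable_twist T I) (H'.indecomposable_twist T I')
  refine ⟨⟨φ, ?_⟩, fun hs => ?_⟩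
  · obtain ⟨hM, hJ⟩ := H.equivariant_of_twist T H' hφ
    refine ⟨hJ, r, hr, fun x y => ?_⟩
    have := hB ((t.map J).prod x) y
    rwa [LinearMap.comp_apply, LinearMap.comp_apply, ← hM, H.twist_sq T] at this
  · obtain ⟨π, hπ⟩ := hpol hs
    obtain ⟨hM, hJ⟩ := H.equivariant_of_twist T H hπ.comm
    refine ⟨π, hJ, hπ.idem, fun x y => ?_⟩
    have := hπ.adj ((t.map J).prod x) y
    rwa [LinearMap.comp_apply, LinearMap.comp_apply, ← hM, H.twist_sq T] at this

theorem hasUniqueForms_of_core [DecidableEq ι] {a b : ι} (ma : a ∈ s) (mb : b ∈ s)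
    (ca : c a = -1) (cb : c b = 1) (h : HasUniqueForms ((s.erase a).erase b) c) :
    HasUniqueForms s c := by
  intro ε δ hε hδ V V' _ _ _ _ J B J' B' nV nV' H H' I I'
  have hδ2 : δ * δ = 1 := by rcases hδ with rfl | rfl <;> norm_num
  have P := H.isHyperbolicPair ma mb ca cb
  have P' := H'.isHyperbolicPair ma mb ca cb
  have nontriv : ∀ {U : Type} [AddCommGroup U] [Module ℝ U] {K : ι → Module.End ℝ U},
      IsHyperbolicPair s c K a b → Nontrivial U → Nontrivial (core K a b) := by
    intro U _ _ K Q nU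
    by_contra hn
    rw [not_nontrivial_iff_subsingleton] at hn
    obtain ⟨u, hu⟩ := exists_ne (0 : U)
    exact hu (Q.ext_proj (Subsingleton.elim _ _) (Subsingleton.elim _ _))
  obtain ⟨⟨φ, hφ, r, hr, hB⟩, hpol⟩ := h (ε * δ) (-δ)
    (by rcases hε with rfl | rfl <;> rcases hδ with rfl | rfl <;> simp)
    (by rcases hδ with rfl | rfl <;> simp) _ _ _ _ _ _
    (nontriv P nV) (nontriv P' nV') (H.coreForm hδ2 P) (H'.coreForm hδ2 P')
    (H.indecomposable_core hδ2 P I) (H'.indecomposable_core hδ2 P' I')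
  refine ⟨⟨P.extend φ, P.extend_equivariant P' φ hφ, r, hr, fun x y => ?_⟩, fun hs => ?_⟩
  · rw [H'.form_eq hδ2 P', H.form_eq hδ2 P]
    simp only [P.proj_extend P', P.proj_a_extend P', hB]
    ring
  · have hcard : s.card / 2 = ((s.erase a).erase b).card / 2 + 1 := by
      have h1 := Finset.card_erase_add_one ma
      have h2 := Finset.card_erase_add_one (Finset.mem_erase.2 ⟨P.ne.symm, mb⟩)
      omega
    rw [hcard] at hs
    obtain ⟨π, hπ⟩ := hpol hs
    refine ⟨P.extend π, P.extend_equivariant P π hπ.comm, fun x => ?_, fun x y => ?_⟩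
    · apply P.ext_proj
      · simp only [P.proj_extend P, hπ.idem]
      · simp only [P.proj_a_extend P, hπ.idem]
    · rw [H.form_eq hδ2 P, H.form_eq hδ2 P]
      simp only [map_sub, P.proj_extend P, P.proj_a_extend P, hπ.adj]

theorem form_expand_of_indecomposable {ε δ : ℝ} {V : Type} [AddCommGroup V] [Module ℝ V]
    {J : ι → Module.End ℝ V} {B : V →ₗ[ℝ] V →ₗ[ℝ] ℝ} (nV : Nontrivial V)
    (H : IsCliffordForm ∅ c ε δ J B) (I : IsIndecomposable ∅ J B) :
    (ε = 1 → ∃ x, B x x ≠ 0 ∧ ∀ v, v = (B x v / B x x) • x) ∧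
    (ε = -1 → ∃ x y, B x x = 0 ∧ B y y = 0 ∧ B x y = 1 ∧ B y x = -1 ∧
      ∀ v, v = (-B y v) • x + B x v • y) := by
  obtain ⟨u, hu⟩ := exists_ne (0 : V)
  have hu' : ∃ w, B u w ≠ 0 := by
    by_contra! h
    exact hu (H.nondeg u h)
  obtain ⟨w, hw⟩ := hu'
  constructor
  · rintro rfl
    have hs := H.symm
    simp only [one_mul] at hs
    have : ∃ x, B x x ≠ 0 := by
      by_contra! h
      have h1 := h (u + w)
      simp only [map_add, LinearMap.add_apply, h u, h w, hs w u] at h1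
      exact hw (by linarith)
    obtain ⟨x, hx⟩ := this
    have x0 : x ≠ 0 := by rintro rfl; simp at hx
    refine ⟨x, hx, fun v => ?_⟩
    have hnd : ∀ z ∈ ℝ ∙ x, (∀ y ∈ ℝ ∙ x, B z y = 0) → z = 0 := by
      intro z hz h0
      obtain ⟨k, rfl⟩ := Submodule.mem_span_singleton.1 hz
      have := h0 x (Submodule.mem_span_singleton_self x)
      simp only [map_smul, LinearMap.smul_apply, smul_eq_mul, mul_eq_zero, hx, or_false] at this
      simp [this]
    rcases I (ℝ ∙ x) (by simp) hnd with h | h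
    · exact absurd (Submodule.span_singleton_eq_bot.1 h) x0
    · have hv : v ∈ ℝ ∙ x := by rw [h]; trivial
      obtain ⟨k, rfl⟩ := Submodule.mem_span_singleton.1 hv
      rw [map_smul, smul_eq_mul, mul_div_assoc, div_self hx, mul_one]
  · rintro rfl
    have hs := H.symm
    have alt : ∀ x, B x x = 0 := fun x => by linarith [hs x x]
    obtain ⟨y, hxy⟩ : ∃ y, B u y = 1 := ⟨(B u w)⁻¹ • w, by simp [hw]⟩
    have hyx : B y u = -1 := by rw [hs, hxy]; norm_num
    refine ⟨u, y, alt u, alt y, hxy, hyx, fun v => ?_⟩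
    have key : ∀ v ∈ Submodule.span ℝ {u, y}, v = (-B y v) • u + B u v • y := by
      intro v hv
      obtain ⟨k, l, rfl⟩ := Submodule.mem_span_pair.1 hv
      simp [hxy, hyx, alt]
    have hnd : ∀ z ∈ Submodule.span ℝ {u, y}, (∀ w ∈ Submodule.span ℝ {u, y}, B z w = 0) →
        z = 0 := by
      intro z hz h0
      have h1 := h0 u (Submodule.subset_span (by simp))
      have h2 := h0 y (Submodule.subset_span (by simp))
      rw [hs] at h1 h2
      rw [key z hz]
      have h1' : B u z = 0 := by linarith
      have h2' : B y z = 0 := by linarith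
      simp [h1', h2']
    rcases I (Submodule.span ℝ {u, y}) (by simp) hnd with h | h
    · have : u ∈ Submodule.span ℝ {u, y} := Submodule.subset_span (by simp)
      rw [h] at this
      exact absurd ((Submodule.mem_bot ℝ).1 this) hu
    · exact key v (by rw [h]; trivial)

theorem hasUniqueForms_empty : HasUniqueForms ∅ c := by
  intro ε δ hε hδ V V' _ _ _ _ J B J' B' nV nV' H H' I I'
  have h := form_expand_of_indecomposable nV H I
  have h' := form_expand_of_indecomposable nV' H' I'
  rcases hε with rfl | rfl
  · obtain ⟨x, hx, hv⟩ := h.1 rfl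
    obtain ⟨x', hx', -⟩ := h'.1 rfl
    refine ⟨⟨((B x x)⁻¹ • B x).smulRight x', by simp, B' x' x' / B x x, by positivity, ?_⟩,
      fun hs => ?_⟩
    · intro v w
      conv_rhs => rw [hv v, hv w]
      simp
      field_simp
    · norm_num [coreSign] at hs
  · obtain ⟨x, y, hx, hy, hxy, hyx, hv⟩ := h.2 rfl
    obtain ⟨x', y', hx', hy', hxy', hyx', -⟩ := h'.2 rfl
    refine ⟨⟨(-B y).smulRight x' + (B x).smulRight y', by simp, 1, one_ne_zero, ?_⟩,
      fun hs => ⟨(-B y).smulRight x, by simp, fun v => ?_, fun v w => ?_⟩⟩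
    · intro v w
      conv_rhs => rw [hv v, hv w]
      simp [hx, hy, hxy, hyx, hx', hy', hxy', hyx']
    · simp [hyx]
    · conv_lhs => rw [hv w]
      simp only [LinearMap.smulRight_apply, LinearMap.neg_apply, map_smul, map_add,
        LinearMap.smul_apply, smul_eq_mul, hx, hxy, map_sub, H.symm v x, H.symm v w]
      conv_rhs => rw [hv v]
      conv_rhs => rw [hv w]
      simp [hx, hy, hxy, hyx]

end Uniqueness

section Classification

variable {ι : Type} [DecidableEq ι] {s : Finset ι}

theorem hasUniqueForms_of_card_eq {c : ι → ℝ} (hc : ∀ i ∈ s, c i = 1 ∨ c i = -1)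
    (h : (s.filter (c · = 1)).card = (s.filter (c · = -1)).card) : HasUniqueForms s c := by
  induction s using Finset.strongInduction with
  | H s ih =>
  rcases s.eq_empty_or_nonempty with rfl | ⟨i, hi⟩
  · exact hasUniqueForms_empty
  have hab : (s.filter (c · = 1)).Nonempty ∧ (s.filter (c · = -1)).Nonempty := by
    rw [← Finset.card_pos, ← Finset.card_pos]
    rcases hc i hi with h1 | h1
    · have : 0 < (s.filter (c · = 1)).card :=
        Finset.card_pos.2 ⟨i, Finset.mem_filter.2 ⟨hi, h1⟩⟩
      omega
    · have : 0 < (s.filter (c · = -1)).card :=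
        Finset.card_pos.2 ⟨i, Finset.mem_filter.2 ⟨hi, h1⟩⟩
      omega
  obtain ⟨⟨b, hb⟩, ⟨a, ha⟩⟩ := hab
  rw [Finset.mem_filter] at ha hb
  have hne : b ≠ a := by
    rintro rfl
    have := ha.2.symm.trans hb.2
    norm_num at this
  refine hasUniqueForms_of_core ha.1 hb.1 ha.2 hb.2 (ih _ ?_ ?_ ?_)
  · exact (Finset.erase_subset _ _).trans_ssubset (Finset.erase_ssubset ha.1)
  · intro j hj
    exact hc j (Finset.mem_of_mem_erase (Finset.mem_of_mem_erase hj))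
  · rw [Finset.filter_erase, Finset.filter_erase, Finset.filter_erase, Finset.filter_erase]
    have hb1 : b ∈ s.filter (c · = 1) := Finset.mem_filter.2 hb
    have ha1 : a ∈ s.filter (c · = -1) := Finset.mem_filter.2 ha
    have ha2 : a ∉ s.filter (c · = 1) := by
      rw [Finset.mem_filter, ha.2]; norm_num
    have hb2 : b ∉ (s.filter (c · = -1)).erase a := by
      rw [Finset.mem_erase, Finset.mem_filter, hb.2]; norm_num
    rw [Finset.erase_eq_of_notMem ha2, Finset.erase_eq_of_notMem hb2,
      Finset.card_erase_of_mem ha1, Finset.card_erase_of_mem hb1, h]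

theorem exists_flipSign {c : ι → ℝ} (hc : ∀ i ∈ s, c i = 1 ∨ c i = -1) {z : ℝ}
    (hz : z = 1 ∨ z = -1) (h : 4 ≤ (s.filter (c · = z)).card) :
    ∃ t : List ι, IsTwistable s c t ∧ revSign t.length = 1 ∧
      (∀ i ∈ s, flipSign t c i = 1 ∨ flipSign t c i = -1) ∧
      (s.filter (flipSign t c · = z)).card + 4 = (s.filter (c · = z)).card ∧
      (s.filter (flipSign t c · = -z)).card = (s.filter (c · = -z)).card + 4 := by
  obtain ⟨t, ht, hcard⟩ := Finset.exists_subset_card_eq h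
  have hz0 : z ≠ -z := by rcases hz with rfl | rfl <;> norm_num
  have hz4 : z ^ 4 = 1 := by rcases hz with rfl | rfl <;> norm_num
  have hlen : t.toList.length = 4 := by rw [Finset.length_toList, hcard]
  have h4 : revSign 4 = 1 := by norm_num [revSign]
  have ht' : ∀ i ∈ t, i ∈ s ∧ c i = z := fun i hi => Finset.mem_filter.1 (ht hi)
  refine ⟨t.toList, ⟨t.nodup_toList, fun i hi => (ht' i (Finset.mem_toList.1 hi)).1, ?_, ?_⟩,
    ?_, ?_, ?_, ?_⟩
  · rw [hlen]; decide
  · rw [hlen, h4, Finset.prod_map_toList, Finset.prod_congr rfl fun i hi => (ht' i hi).2]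
    simp [hcard, hz4]
  · rw [hlen, h4]
  · intro i hi
    simp only [flipSign]
    rcases hc i hi with h1 | h1 <;> rw [h1] <;> split_ifs <;> simp
  · have : s.filter (flipSign t.toList c · = z) = s.filter (c · = z) \ t := by
      ext i
      by_cases hi : i ∈ t
      · simp only [Finset.mem_filter, Finset.mem_sdiff, flipSign, Finset.mem_toList, hi, if_true,
          (ht' i hi).2, hz0.symm]
        simp
      · simp [flipSign, hi]
    rw [this, Finset.card_sdiff_of_subset ht]
    omega
  · have : s.filter (flipSign t.toList c · = -z) = s.filter (c · = -z) ∪ t := by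
      ext i
      by_cases hi : i ∈ t
      · simp [flipSign, hi, ht' i hi]
      · simp [flipSign, hi]
    rw [this, Finset.card_union_of_disjoint, hcard]
    rw [Finset.disjoint_left]
    intro i hi hit
    exact hz0 ((ht' i hit).2.symm.trans (Finset.mem_filter.1 hi).2)

theorem hasUniqueForms_of_card_eq_add (k : ℕ) {c : ι → ℝ} (hc : ∀ i ∈ s, c i = 1 ∨ c i = -1)
    {z : ℝ} (hz : z = 1 ∨ z = -1)
    (h : (s.filter (c · = z)).card = (s.filter (c · = -z)).card + 8 * k) :
    HasUniqueForms s c := by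
  induction k generalizing c with
  | zero =>
    refine hasUniqueForms_of_card_eq hc ?_
    rcases hz with rfl | rfl
    · simpa using h
    · simpa using h.symm
  | succ k ih =>
    obtain ⟨t, T, h1, hc', h2, h3⟩ := exists_flipSign hc hz (by omega)
    exact hasUniqueForms_of_flipSign T h1 (ih hc' (by omega))

end Classification

section Duality

variable {ι : Type} {s : Finset ι} {c : ι → ℝ}
  {V : Type} [AddCommGroup V] [Module ℝ V] {J : ι → Module.End ℝ V} {B : V →ₗ[ℝ] V →ₗ[ℝ] ℝ}

theorem IsCliffordForm.twist_of_skew [DecidableEq ι] (H : IsCliffordForm s c 1 (-1) J B) {t : List ι}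
    (T : IsTwistable s c t) (ht : ∀ i ∈ s, i ∈ t) (hsign : revSign t.length = -1) :
    IsCliffordForm s (flipSign t c) 1 (-1) (_root_.twist t J) B where
  sq _ hi := H.twist_square T hi
  anti _ hi _ hj hij := H.twist_anticomm T hi hj hij
  symm := H.symm
  adj i hi x y := by
    simp only [_root_.twist, ht i hi, if_true, Module.End.mul_apply]
    rw [H.word_adj t T.subset T.nodup, hsign, T.even.neg_one_pow, H.adj i hi,
      H.twist_anti T (ht i hi), map_neg]
    ring
  nondeg := H.nondeg

theorem IsSimilarity.bijective {ε δ : ℝ} {V' : Type} [AddCommGroup V'] [Module ℝ V']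
    {J' : ι → Module.End ℝ V'} {B' : V' →ₗ[ℝ] V' →ₗ[ℝ] ℝ} {φ : V →ₗ[ℝ] V'}
    (hφ : IsSimilarity s J B J' B' φ) (H : IsCliffordForm s c ε δ J B) (nV : Nontrivial V)
    (I : IsIndecomposable s J' B') : Function.Bijective φ := by
  obtain ⟨hJ, r, hr, hB⟩ := hφ
  have hinj : Function.Injective φ := by
    rw [injective_iff_map_eq_zero]
    intro x hx
    refine H.nondeg x fun y => ?_
    have := hB x y
    rw [hx] at this
    simpa [hr] using this.symm
  refine ⟨hinj, ?_⟩
  have hnd : ∀ x ∈ LinearMap.range φ, (∀ y ∈ LinearMap.range φ, B' x y = 0) → x = 0 := by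
    rintro _ ⟨x, rfl⟩ h
    have : x = 0 := H.nondeg x fun y => by
      have h1 := h (φ y) ⟨y, rfl⟩
      rw [hB] at h1
      simpa [hr] using h1
    rw [this, map_zero]
  have hinv : ∀ i ∈ s, ∀ x ∈ LinearMap.range φ, J' i x ∈ LinearMap.range φ := by
    rintro i hi _ ⟨x, rfl⟩
    exact ⟨J i x, hJ i hi x⟩
  rcases I (LinearMap.range φ) hinv hnd with h | h
  · obtain ⟨x, hx⟩ := exists_ne (0 : V)
    have : φ x ∈ LinearMap.range φ := ⟨x, rfl⟩
    rw [h, Submodule.mem_bot] at this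
    exact absurd (hinj (this.trans (map_zero φ).symm)) hx
  · exact LinearMap.range_eq_top.1 h

/-- The Lie algebras of two indecomposable modules with opposite signs are isomorphic. -/
theorem exists_equiv_of_flipSign [DecidableEq ι] {V' : Type} [AddCommGroup V'] [Module ℝ V']
    {J' : ι → Module.End ℝ V'} {B' : V' →ₗ[ℝ] V' →ₗ[ℝ] ℝ} {t : List ι}
    (ht : ∀ i ∈ s, i ∈ t) (T : IsTwistable s c t) (huniq : HasUniqueForms s (flipSign t c))
    (hsign : revSign t.length = 1 ∨
      revSign t.length = -1 ∧ coreSign (s.card / 2) 1 (-1) = -1)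
    (nV : Nontrivial V) (nV' : Nontrivial V')
    (H : IsCliffordForm s (flipSign t c) 1 (-1) J B) (H' : IsCliffordForm s c 1 (-1) J' B')
    (I : IsIndecomposable s J B) (I' : IsIndecomposable s J' B') :
    ∃ (A : V ≃ₗ[ℝ] V') (r : ℝ), r ≠ 0 ∧
      ∀ i ∈ s, ∀ x y, B' (J' i (A x)) (A y) = r * B (J i x) y := by
  rcases hsign with hsign | ⟨hsign, hcore⟩
  · have I'' := H'.indecomposable_twist T I'
    obtain ⟨φ, hφ⟩ := (huniq 1 (-1) (by simp) (by simp) V V' _ _ _ _ nV nV' H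
      (H'.twist T (by simp [hsign, T.even.neg_one_pow])) I I'').1
    refine ⟨LinearEquiv.ofBijective φ (hφ.bijective H nV I''), ?_⟩
    obtain ⟨hJ, r, hr, hB⟩ := hφ
    refine ⟨r, hr, fun i hi x y => ?_⟩
    rw [← hB, hJ i hi]
    simp [twist, ht i hi, H'.twist_sq T]
  · have H'' := H'.twist_of_skew T ht hsign
    have I'' : IsIndecomposable s (twist t J') B' := fun W hW =>
      I' W (H'.mem_of_twist T hW).2
    obtain ⟨φ, hφ⟩ := (huniq 1 (-1) (by simp) (by simp) V V' _ _ _ _ nV nV' H H'' I I'').1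
    obtain ⟨π, hπ⟩ := (huniq 1 (-1) (by simp) (by simp) V' V' _ _ _ _ nV' nV' H'' H'' I'' I'').2
      hcore
    obtain ⟨πM, πJ⟩ := H'.equivariant_of_twist T H' hπ.comm
    set M := (t.map J').prod with hM
    have MM : ∀ v, M (M v) = v := H'.twist_sq T
    have Mskew : ∀ v w, B' (M v) w = -B' v (M w) := fun v w => by
      rw [hM, H'.word_adj t T.subset T.nodup, hsign, T.even.neg_one_pow]
      ring
    let A₀ : V' →ₗ[ℝ] V' := π + M ∘ₗ (LinearMap.id - π)
    have A₀_apply : ∀ v, A₀ v = π v + M (v - π v) := fun v => rfl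
    have A₀A₀ : ∀ v, A₀ (A₀ v) = v := fun v => by
      simp only [A₀_apply, map_add, map_sub, πM, hπ.idem, MM]
      abel
    have hA₀ : ∀ i ∈ s, ∀ v w, B' (J' i (A₀ v)) (A₀ w) = -B' (twist t J' i v) w := by
      intro i hi v w
      have K : ∀ v, twist t J' i v = M (J' i v) := fun v => by simp [twist, ht i hi, hM]
      have JM : ∀ v, J' i (M v) = -M (J' i v) := H'.twist_anti T (ht i hi)
      have h1 := hπ.adj (J' i v) w
      have h2 := hπ.adj (J' i v) (π w)
      have h3 := hπ.adj (M (J' i v)) w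
      have h4 := hπ.adj (M (J' i v)) (π w)
      have h5 := hπ.adj (J' i v) (M w)
      have h6 := hπ.adj (J' i v) (π (M w))
      have h7 := hπ.adj (M (J' i v)) (M w)
      have h8 := hπ.adj (M (J' i v)) (π (M w))
      simp only [A₀_apply, K, map_add, map_sub, LinearMap.add_apply, LinearMap.sub_apply, JM,
        ← πJ i hi, ← πM, hπ.idem, map_neg, Mskew, MM,
        LinearMap.neg_apply] at h1 h2 h3 h4 h5 h6 h7 h8 ⊢
      linarith
    let e₀ : V' ≃ₗ[ℝ] V' := LinearEquiv.ofInvolutive A₀ A₀A₀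
    refine ⟨(LinearEquiv.ofBijective φ (hφ.bijective H nV I'')).trans e₀, ?_⟩
    obtain ⟨hJ, r, hr, hB⟩ := hφ
    refine ⟨-r, neg_ne_zero.2 hr, fun i hi x y => ?_⟩
    change B' (J' i (A₀ (φ x))) (A₀ (φ y)) = _
    rw [hA₀ i hi, ← hJ i hi, hB]
    ring

end Duality

section Admissible

/-- The square of the `i`-th generator of the Clifford algebra of signature `(r, s)`. -/
def genSq (r s : ℕ) (i : Fin (r + s)) : ℝ := if (i : ℕ) < r then -1 else 1

theorem sform_single (r s : ℕ) (i : Fin (r + s)) (W : Fin (r + s) → ℝ) :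
    sform r s (Pi.single i 1) W = -genSq r s i * W i := by
  rw [sform, Finset.sum_eq_single i]
  · simp only [genSq, Pi.single_eq_same]
    split_ifs <;> ring
  · intro j _ hj
    simp [Pi.single_eq_of_ne hj]
  · simp

theorem sform_add_self (r s : ℕ) (Z W : Fin (r + s) → ℝ) :
    sform r s (Z + W) (Z + W) = sform r s Z Z + sform r s W W + 2 * sform r s Z W := by
  simp only [sform, Finset.mul_sum, ← Finset.sum_add_distrib, Pi.add_apply]
  refine Finset.sum_congr rfl fun i _ => ?_
  ring

theorem card_filter_genSq_neg (r s : ℕ) :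
    ((Finset.univ : Finset (Fin (r + s))).filter (genSq r s · = -1)).card = r := by
  have : (Finset.univ : Finset (Fin (r + s))).filter (genSq r s · = -1)
      = Finset.univ.filter fun i : Fin (r + s) => (i : ℕ) < r := by
    ext i
    by_cases h : (i : ℕ) < r <;> norm_num [genSq, h]
  rw [this, Fin.card_filter_val_lt]
  simp

theorem card_filter_genSq_pos (r s : ℕ) :
    ((Finset.univ : Finset (Fin (r + s))).filter (genSq r s · = 1)).card = s := by
  have : (Finset.univ : Finset (Fin (r + s))).filter (genSq r s · = 1)
      = Finset.univ.filter fun i : Fin (r + s) => ¬ (genSq r s i = -1) := by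
    ext i
    by_cases h : (i : ℕ) < r <;> norm_num [genSq, h]
  have h := Finset.card_filter_add_card_filter_not (s := (Finset.univ : Finset (Fin (r + s))))
    (genSq r s · = -1)
  rw [card_filter_genSq_neg, Finset.card_univ, Fintype.card_fin] at h
  rw [this]
  omega

theorem prod_genSq (r s : ℕ) : ∏ i, genSq r s i = (-1) ^ r := by
  have := Fin.prod_univ_add (genSq r s)
  rw [this]
  simp [genSq]

theorem genSq_finAddFlip (r s : ℕ) (i : Fin (r + s)) :
    genSq s r (finAddFlip i) = -genSq r s i := by
  refine Fin.addCases (fun i => ?_) (fun i => ?_) i <;> simp [genSq]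

theorem hasUniqueForms_genSq {r s k : ℕ} (h : s = r + 8 * k ∨ r = s + 8 * k) :
    HasUniqueForms Finset.univ (genSq r s) := by
  have hc : ∀ i ∈ Finset.univ, genSq r s i = 1 ∨ genSq r s i = -1 := by
    intro i _
    simp only [genSq]
    split_ifs <;> simp
  rcases h with h | h
  · refine hasUniqueForms_of_card_eq_add k hc (z := 1) (by simp) ?_
    rw [card_filter_genSq_neg, card_filter_genSq_pos, h]
  · refine hasUniqueForms_of_card_eq_add k hc (z := -1) (by simp) ?_
    rw [neg_neg, card_filter_genSq_neg, card_filter_genSq_pos, h]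

variable {r s : ℕ} {V : Type} [AddCommGroup V] [Module ℝ V] {B : V →ₗ[ℝ] V →ₗ[ℝ] ℝ}
  {J : (Fin (r + s) → ℝ) →ₗ[ℝ] V →ₗ[ℝ] V}

theorem IsAdmissible.isCliffordForm (H : IsAdmissible r s V B J) :
    IsCliffordForm Finset.univ (genSq r s) 1 (-1) (fun i => J (Pi.single i 1)) B := by
  obtain ⟨-, -, hsymm, hnd, hsq, hadj⟩ := H
  refine ⟨fun i _ v => ?_, fun i _ j _ hij v => ?_, fun x y => ?_, fun i _ x y => ?_, hnd⟩
  · rw [hsq, sform_single]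
    simp
  · have h := hsq (Pi.single i 1 + Pi.single j 1) v
    rw [sform_add_self, map_add, LinearMap.add_apply, LinearMap.add_apply, map_add, map_add, hsq,
      hsq, sform_single r s i (Pi.single j 1), Pi.single_eq_of_ne hij] at h
    rw [eq_neg_iff_add_eq_zero]
    linear_combination (norm := module) h
  · rw [hsymm, one_mul]
  · rw [hadj, neg_one_mul]

theorem IsMinimalAdmissible.isIndecomposable (H : IsMinimalAdmissible r s V B J) :
    IsIndecomposable Finset.univ (fun i => J (Pi.single i 1)) B := by
  obtain ⟨⟨hfin, hnt, hsymm, hnd, hsq, hadj⟩, hmin⟩ := H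
  intro W hW hWnd
  have hJW : ∀ Z, ∀ x ∈ W, J Z x ∈ W := by
    intro Z x hx
    rw [pi_eq_sum_univ' Z, map_sum, LinearMap.sum_apply]
    refine W.sum_mem fun i _ => ?_
    rw [map_smul, LinearMap.smul_apply]
    refine W.smul_mem _ ?_
    convert hW i (Finset.mem_univ i) x hx using 4
  rw [or_iff_not_imp_left]
  intro hbot
  let JW : (Fin (r + s) → ℝ) →ₗ[ℝ] W →ₗ[ℝ] W :=
    { toFun := fun Z => (J Z).restrict (hJW Z)
      map_add' := fun Z Z' => by ext; simp
      map_smul' := fun k Z => by ext; simp }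
  have hle := hmin W (B.domRestrict₁₂ W W) JW
    ⟨inferInstance, (Submodule.nontrivial_iff_ne_bot).2 hbot, fun v w => hsymm v w,
      fun v hv => Subtype.ext (hWnd v v.2 fun y hy => hv ⟨y, hy⟩),
      fun Z v => Subtype.ext (hsq Z v), fun Z v w => hadj Z v w⟩
  exact Submodule.eq_top_of_finrank_eq (le_antisymm W.finrank_le hle)

end Admissible

theorem exists_lieIso_of_equiv {r s : ℕ} {V₁ V₂ : Type} [AddCommGroup V₁] [Module ℝ V₁]
    [AddCommGroup V₂] [Module ℝ V₂]
    {B₁ : V₁ →ₗ[ℝ] V₁ →ₗ[ℝ] ℝ} {J₁ : (Fin (r + s) → ℝ) →ₗ[ℝ] V₁ →ₗ[ℝ] V₁}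
    {br₁ : V₁ →ₗ[ℝ] V₁ →ₗ[ℝ] (Fin (r + s) → ℝ)} (h₁ : IsHBracket r s V₁ B₁ J₁ br₁)
    {B₂ : V₂ →ₗ[ℝ] V₂ →ₗ[ℝ] ℝ} {J₂ : (Fin (s + r) → ℝ) →ₗ[ℝ] V₂ →ₗ[ℝ] V₂}
    {br₂ : V₂ →ₗ[ℝ] V₂ →ₗ[ℝ] (Fin (s + r) → ℝ)} (h₂ : IsHBracket s r V₂ B₂ J₂ br₂)
    (A : V₁ ≃ₗ[ℝ] V₂) {μ : ℝ} (hμ : μ ≠ 0)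
    (hA : ∀ i x y, B₂ (J₂ (Pi.single (finAddFlip i) 1) (A x)) (A y)
      = μ * B₁ (J₁ (Pi.single i 1) x) y) :
    ∃ f : (V₁ × (Fin (r + s) → ℝ)) ≃ₗ[ℝ] (V₂ × (Fin (s + r) → ℝ)), IsLieIso br₁ br₂ f := by
  let C : (Fin (r + s) → ℝ) ≃ₗ[ℝ] (Fin (s + r) → ℝ) :=
    (LinearEquiv.smulOfNeZero ℝ _ (-μ) (neg_ne_zero.2 hμ)).trans
      (LinearEquiv.funCongrLeft ℝ ℝ finAddFlip.symm)
  refine ⟨A.prodCongr C, fun x y => ?_⟩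
  ext1
  · simp
  · funext j
    obtain ⟨i, rfl⟩ := finAddFlip.surjective j
    have h1 := h₁ (Pi.single i 1) x.1 y.1
    have h2 := h₂ (Pi.single (finAddFlip i) 1) (A x.1) (A y.1)
    rw [sform_single] at h1 h2
    rw [genSq_finAddFlip, hA, ← h1] at h2
    have hg : genSq r s i ≠ 0 := by
      simp only [genSq]
      split_ifs <;> norm_num
    have h3 : br₂ (A x.1) (A y.1) (finAddFlip i) = -μ * br₁ x.1 y.1 i :=
      mul_left_cancel₀ hg (by linear_combination h2)
    simpa [C, LinearEquiv.funCongrLeft, LinearMap.funLeft] using h3.symm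

theorem exists_lieIso {p q k m : ℕ} (hpq : q = p + 8 * k ∨ p = q + 8 * k) (hm : p + q = 2 * m)
    (hmod : m % 4 = p % 4) (hp : p % 4 = 0 ∨ p % 4 = 1 ∨ p % 4 = 2)
    {V₁ V₂ : Type} [AddCommGroup V₁] [Module ℝ V₁] [AddCommGroup V₂] [Module ℝ V₂]
    {B₁ : V₁ →ₗ[ℝ] V₁ →ₗ[ℝ] ℝ} {J₁ : (Fin (p + q) → ℝ) →ₗ[ℝ] V₁ →ₗ[ℝ] V₁}
    {br₁ : V₁ →ₗ[ℝ] V₁ →ₗ[ℝ] (Fin (p + q) → ℝ)}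
    (H₁ : IsMinimalAdmissible p q V₁ B₁ J₁) (h₁ : IsHBracket p q V₁ B₁ J₁ br₁)
    {B₂ : V₂ →ₗ[ℝ] V₂ →ₗ[ℝ] ℝ} {J₂ : (Fin (q + p) → ℝ) →ₗ[ℝ] V₂ →ₗ[ℝ] V₂}
    {br₂ : V₂ →ₗ[ℝ] V₂ →ₗ[ℝ] (Fin (q + p) → ℝ)}
    (H₂ : IsMinimalAdmissible q p V₂ B₂ J₂) (h₂ : IsHBracket q p V₂ B₂ J₂ br₂) :
    ∃ f : (V₁ × (Fin (p + q) → ℝ)) ≃ₗ[ℝ] (V₂ × (Fin (q + p) → ℝ)), IsLieIso br₁ br₂ f := by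
  let t := (Finset.univ : Finset (Fin (p + q))).toList
  have ht : ∀ i ∈ (Finset.univ : Finset (Fin (p + q))), i ∈ t := by simp [t]
  have hlen : t.length = 2 * m := by simp [t, hm]
  have hflip : flipSign t (fun i => -genSq p q i) = genSq p q := by
    funext i
    simp [flipSign, t]
  have hrev : revSign t.length = (-1) ^ m := by rw [hlen, revSign_two_mul]
  have hmp : (-1 : ℝ) ^ q * (-1) ^ m = 1 := by
    rw [← pow_add]
    exact Even.neg_one_pow (by rw [Nat.even_iff]; omega)
  have hprod : (t.map fun i => -genSq p q i).prod = (-1 : ℝ) ^ q := by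
    rw [Finset.prod_map_toList, ← prod_genSq q p]
    exact Fintype.prod_equiv finAddFlip _ _ fun i => (genSq_finAddFlip p q i).symm
  have T : IsTwistable Finset.univ (fun i => -genSq p q i) t :=
    ⟨Finset.nodup_toList _, by simp, by rw [hlen]; simp, by rw [hprod, hrev, hmp]⟩
  have F₂ := H₂.1.isCliffordForm
  have F₂' : IsCliffordForm Finset.univ (fun i => -genSq p q i) 1 (-1)
      (fun i => J₂ (Pi.single (finAddFlip i) 1)) B₂ :=
    ⟨fun i _ v => by rw [← genSq_finAddFlip]; exact F₂.sq _ (Finset.mem_univ _) v,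
      fun i _ j _ hij => F₂.anti _ (Finset.mem_univ _) _ (Finset.mem_univ _)
        (finAddFlip.injective.ne hij),
      F₂.symm, fun i _ => F₂.adj _ (Finset.mem_univ _), F₂.nondeg⟩
  have I₂ : IsIndecomposable Finset.univ
      (fun i : Fin (p + q) => J₂ (Pi.single (finAddFlip i) 1)) B₂ := fun W hW =>
    H₂.isIndecomposable W fun j _ => by
      obtain ⟨i, rfl⟩ := finAddFlip.surjective j
      exact hW i (Finset.mem_univ i)
  have hsign : revSign t.length = 1 ∨ revSign t.length = -1 ∧
      coreSign ((Finset.univ : Finset (Fin (p + q))).card / 2) 1 (-1) = -1 := by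
    rw [hrev]
    rcases Nat.even_or_odd m with he | ho
    · exact Or.inl he.neg_one_pow
    · refine Or.inr ⟨ho.neg_one_pow, ?_⟩
      have hm4 : (Finset.univ : Finset (Fin (p + q))).card / 2 = 4 * (m / 4) + 1 := by
        rw [Finset.card_univ, Fintype.card_fin]
        have := Nat.odd_iff.1 ho
        omega
      rw [hm4, coreSign_eq_neg_one]
  obtain ⟨A, μ, hμ, hA⟩ := exists_equiv_of_flipSign ht T
    (by rw [hflip]; exact hasUniqueForms_genSq hpq) hsign H₁.1.2.1 H₂.1.2.1
    (by rw [hflip]; exact H₁.1.isCliffordForm) F₂' H₁.isIndecomposable I₂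
  exact exists_lieIso_of_equiv h₁ h₂ A hμ fun i => hA i (Finset.mem_univ i)

theorem stmt12 (r t₁ t₂ t₃ : ℕ)
    (hr : r % 4 = 0 ∨ r % 4 = 1 ∨ r % 4 = 2)
    (V1 : Type) [AddCommGroup V1] [Module ℝ V1]
    (B1 : V1 →ₗ[ℝ] V1 →ₗ[ℝ] ℝ)
    (J1 : (Fin ((r + 8 * t₁ + 4 * t₂) + (r + 8 * t₃ + 4 * t₂)) → ℝ) →ₗ[ℝ] V1 →ₗ[ℝ] V1)
    (br1 : V1 →ₗ[ℝ] V1 →ₗ[ℝ] (Fin ((r + 8 * t₁ + 4 * t₂) + (r + 8 * t₃ + 4 * t₂)) → ℝ))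
    (hadm1 : IsMinimalAdmissible (r + 8 * t₁ + 4 * t₂) (r + 8 * t₃ + 4 * t₂) V1 B1 J1)
    (hbr1 : IsHBracket (r + 8 * t₁ + 4 * t₂) (r + 8 * t₃ + 4 * t₂) V1 B1 J1 br1)
    (V2 : Type) [AddCommGroup V2] [Module ℝ V2]
    (B2 : V2 →ₗ[ℝ] V2 →ₗ[ℝ] ℝ)
    (J2 : (Fin ((r + 8 * t₃ + 4 * t₂) + (r + 8 * t₁ + 4 * t₂)) → ℝ) →ₗ[ℝ] V2 →ₗ[ℝ] V2)
    (br2 : V2 →ₗ[ℝ] V2 →ₗ[ℝ] (Fin ((r + 8 * t₃ + 4 * t₂) + (r + 8 * t₁ + 4 * t₂)) → ℝ))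
    (hadm2 : IsMinimalAdmissible (r + 8 * t₃ + 4 * t₂) (r + 8 * t₁ + 4 * t₂) V2 B2 J2)
    (hbr2 : IsHBracket (r + 8 * t₃ + 4 * t₂) (r + 8 * t₁ + 4 * t₂) V2 B2 J2 br2)
    :
    ∃ f : (V1 × (Fin ((r + 8 * t₁ + 4 * t₂) + (r + 8 * t₃ + 4 * t₂)) → ℝ)) ≃ₗ[ℝ]
          (V2 × (Fin ((r + 8 * t₃ + 4 * t₂) + (r + 8 * t₁ + 4 * t₂)) → ℝ)),
      IsLieIso br1 br2 f := by
  rcases le_total t₁ t₃ with h | h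
  · exact exists_lieIso (k := t₃ - t₁) (m := r + 4 * (t₁ + t₂ + t₃)) (by omega) (by omega)
      (by omega) (by omega) hadm1 hbr1 hadm2 hbr2
  · exact exists_lieIso (k := t₁ - t₃) (m := r + 4 * (t₁ + t₂ + t₃)) (by omega) (by omega)
      (by omega) (by omega) hadm1 hbr1 hadm2 hbr2
end

section
/- No pseudo H-type Lie algebra n_{3,2} built on a minimal admissible Cl_{3,2}-module is isomorphic as a Lie algebra to a pseudo H-type Lie algebra n_{2,3} built on a minimal admissible Cl_{2,3}-module. -/
/-- Linear maps between spaces with bilinear forms have adjoints when the form on the source is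
nondegenerate. -/
theorem exists_adjoint {V W : Type*} [AddCommGroup V] [Module ℝ V] [FiniteDimensional ℝ V]
    [AddCommGroup W] [Module ℝ W] (B : V →ₗ[ℝ] V →ₗ[ℝ] ℝ)
    (hB : ∀ v : V, (∀ w : V, B v w = 0) → v = 0) (B' : W →ₗ[ℝ] W →ₗ[ℝ] ℝ) (A : V →ₗ[ℝ] W) :
    ∃ A' : W →ₗ[ℝ] V, ∀ u y, B' u (A y) = B (A' u) y := by
  have hinj : Function.Injective B := by
    rw [← LinearMap.ker_eq_bot, LinearMap.ker_eq_bot']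
    intro v hv
    exact hB v fun w => by simp [hv]
  let e : V ≃ₗ[ℝ] Module.Dual ℝ V :=
    LinearMap.linearEquivOfInjective B hinj Subspace.dual_finrank_eq.symm
  have he : ∀ φ, B (e.symm φ) = φ := fun φ => e.apply_symm_apply φ
  refine ⟨e.symm.toLinearMap ∘ₗ B'.compl₂ A, fun u y => ?_⟩
  simp [he]

/-- The scalar product of signature `(r,s)` as a bilinear map. -/
noncomputable def sformBilin (r s : ℕ) : (Fin (r + s) → ℝ) →ₗ[ℝ] (Fin (r + s) → ℝ) →ₗ[ℝ] ℝ :=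
  LinearMap.mk₂ ℝ (sform r s)
    (fun _ _ _ => by
      simp only [sform, ← Finset.sum_add_distrib]
      exact Finset.sum_congr rfl fun i _ => by simp only [Pi.add_apply]; ring)
    (fun _ _ _ => by
      simp only [sform, smul_eq_mul, Finset.mul_sum]
      exact Finset.sum_congr rfl fun i _ => by simp only [Pi.smul_apply, smul_eq_mul]; ring)
    (fun _ _ _ => by
      simp only [sform, ← Finset.sum_add_distrib]
      exact Finset.sum_congr rfl fun i _ => by simp only [Pi.add_apply]; ring)
    (fun _ _ _ => by
      simp only [sform, smul_eq_mul, Finset.mul_sum]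
      exact Finset.sum_congr rfl fun i _ => by simp only [Pi.smul_apply, smul_eq_mul]; ring)

@[simp]
theorem sformBilin_apply (r s : ℕ) (Z W : Fin (r + s) → ℝ) : sformBilin r s Z W = sform r s Z W :=
  rfl

theorem sform_comm (r s : ℕ) (Z W : Fin (r + s) → ℝ) : sform r s Z W = sform r s W Z :=
  Finset.sum_congr rfl fun i _ => by ring

theorem sform_nondegenerate (r s : ℕ) (Z : Fin (r + s) → ℝ) (h : ∀ W, sform r s Z W = 0) :
    Z = 0 := by
  funext i
  have := h (Pi.single i 1)
  simp only [sform, Pi.single_apply, mul_ite, mul_one, mul_zero, Finset.sum_ite_eq',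
    Finset.mem_univ, if_true] at this
  split_ifs at this <;> simpa using this

namespace IsAdmissible

variable {r s : ℕ} {V : Type} [AddCommGroup V] [Module ℝ V] {B : V →ₗ[ℝ] V →ₗ[ℝ] ℝ}
  {J : (Fin (r + s) → ℝ) →ₗ[ℝ] V →ₗ[ℝ] V}

theorem clifford_polar (h : IsAdmissible r s V B J) (Z W : Fin (r + s) → ℝ) (v : V) :
    J Z (J W v) + J W (J Z v) = (-(2 * sform r s Z W)) • v := by
  obtain ⟨-, -, -, -, hJ, -⟩ := h
  have h1 := hJ (Z + W) v
  have h2 : sform r s (Z + W) (Z + W)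
      = sform r s Z Z + 2 * sform r s Z W + sform r s W W := by
    simp only [← sformBilin_apply, map_add, LinearMap.add_apply]
    simp only [sformBilin_apply, sform_comm r s W Z]
    ring
  simp only [map_add, LinearMap.add_apply, hJ, h2] at h1
  rw [← sub_eq_zero] at h1 ⊢
  rw [← h1]
  module

theorem eq_zero_of_clifford_eq_zero (h : IsAdmissible r s V B J) (Z : Fin (r + s) → ℝ)
    (hZ : ∀ v, J Z v = 0) : Z = 0 := by
  have hV : Nontrivial V := h.2.1
  obtain ⟨v, hv⟩ := exists_ne (0 : V)
  refine sform_nondegenerate r s Z fun W => ?_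
  have := h.clifford_polar Z W v
  simp only [hZ, map_zero, add_zero] at this
  simpa [hv] using this.symm

/-- The centre of a pseudo `H`-type algebra is spanned by brackets, so a linear subspace
containing all brackets is everything. -/
theorem bracket_span_eq_top (h : IsAdmissible r s V B J)
    {br : V →ₗ[ℝ] V →ₗ[ℝ] (Fin (r + s) → ℝ)} (hbr : IsHBracket r s V B J br)
    (K : Submodule ℝ (Fin (r + s) → ℝ)) (hK : ∀ v w, br v w ∈ K) : K = ⊤ := by
  by_contra hne
  obtain ⟨φ, hφ, hle⟩ := K.exists_le_ker_of_lt_top (lt_top_iff_ne_top.2 hne)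
  obtain ⟨Z', hZ'⟩ := exists_adjoint (sformBilin r s) (sform_nondegenerate r s)
    (LinearMap.mul ℝ ℝ) φ
  have hZ : ∀ W, sform r s (Z' 1) W = φ W := fun W => by simpa using (hZ' 1 W).symm
  have hzero : Z' 1 = 0 := by
    refine h.eq_zero_of_clifford_eq_zero _ fun v => h.2.2.2.1 _ fun w => ?_
    rw [← hbr, hZ]
    exact hle (hK v w)
  apply hφ
  ext1 i
  ext
  simp [← hZ, hzero, sform]

end IsAdmissible

theorem IsLieIso.symm {V₁ : Type} [AddCommGroup V₁] [Module ℝ V₁]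
    {V₂ : Type} [AddCommGroup V₂] [Module ℝ V₂] {n₁ n₂ : ℕ}
    {br₁ : V₁ →ₗ[ℝ] V₁ →ₗ[ℝ] (Fin n₁ → ℝ)} {br₂ : V₂ →ₗ[ℝ] V₂ →ₗ[ℝ] (Fin n₂ → ℝ)}
    {f : (V₁ × (Fin n₁ → ℝ)) ≃ₗ[ℝ] (V₂ × (Fin n₂ → ℝ))} (hf : IsLieIso br₁ br₂ f) :
    IsLieIso br₂ br₁ f.symm := by
  intro x y
  rw [LinearEquiv.symm_apply_eq, hf]
  simp

theorem IsLieIso.map_center {r s n : ℕ} {V₁ : Type} [AddCommGroup V₁] [Module ℝ V₁]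
    {V₂ : Type} [AddCommGroup V₂] [Module ℝ V₂] {B : V₁ →ₗ[ℝ] V₁ →ₗ[ℝ] ℝ}
    {J : (Fin (r + s) → ℝ) →ₗ[ℝ] V₁ →ₗ[ℝ] V₁}
    {br₁ : V₁ →ₗ[ℝ] V₁ →ₗ[ℝ] (Fin (r + s) → ℝ)} {br₂ : V₂ →ₗ[ℝ] V₂ →ₗ[ℝ] (Fin n → ℝ)}
    {f : (V₁ × (Fin (r + s) → ℝ)) ≃ₗ[ℝ] (V₂ × (Fin n → ℝ))}
    (hf : IsLieIso br₁ br₂ f) (h : IsAdmissible r s V₁ B J) (hbr : IsHBracket r s V₁ B J br₁)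
    (z : Fin (r + s) → ℝ) : (f (0, z)).1 = 0 := by
  have htop := h.bracket_span_eq_top hbr
    (LinearMap.ker (LinearMap.fst ℝ _ _ ∘ₗ f.toLinearMap ∘ₗ LinearMap.inr ℝ _ _))
    fun v w => by simpa using congrArg Prod.fst (hf (v, 0) (w, 0))
  have hz := htop ▸ Submodule.mem_top (x := z)
  simpa using hz

/-- A symmetric bilinear form vanishing on the null cone of `⟨·,·⟩_{2,3}` is proportional to it. -/
theorem exists_eq_mul_sform (G : (Fin (2 + 3) → ℝ) →ₗ[ℝ] (Fin (2 + 3) → ℝ) →ₗ[ℝ] ℝ)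
    (hsymm : ∀ Z W, G Z W = G W Z) (hnull : ∀ Z, sform 2 3 Z Z = 0 → G Z Z = 0) :
    ∃ c, ∀ Z, G Z Z = c * sform 2 3 Z Z := by
  let g : Fin 5 → Fin 5 → ℝ := fun i j => G (Pi.single i 1) (Pi.single j 1)
  have hg : ∀ i j, g i j = g j i := fun i j => hsymm _ _
  have hG : ∀ Z : Fin 5 → ℝ, G Z Z = ∑ i, ∑ j, Z i * Z j * g i j := by
    intro Z
    conv_lhs => rw [pi_eq_sum_univ' Z]
    simp only [map_sum, map_smul, LinearMap.sum_apply, LinearMap.smul_apply, smul_eq_mul,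
      Finset.mul_sum]
    rw [Finset.sum_comm]
    refine Finset.sum_congr rfl fun i _ => Finset.sum_congr rfl fun j _ => ?_
    have hsingle : ∀ k : Fin 5, (fun l => if l = k then (1 : ℝ) else 0) = Pi.single k 1 :=
      fun k => by ext l; simp [Pi.single_apply]
    simp only [g, ← hsingle]
    ring
  have hs : ∀ Z : Fin 5 → ℝ, sform 2 3 Z Z
      = Z 0 ^ 2 + Z 1 ^ 2 - Z 2 ^ 2 - Z 3 ^ 2 - Z 4 ^ 2 := by
    intro Z
    simp only [sform]
    rw [show (∑ i : Fin (2 + 3), (if (i : ℕ) < 2 then (1 : ℝ) else -1) * Z i * Z i)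
      = ∑ i : Fin 5, (if (i : ℕ) < 2 then (1 : ℝ) else -1) * Z i * Z i from rfl]
    simp [Fin.sum_univ_five]
    ring
  have key : ∀ a b c d e : ℝ, a ^ 2 + b ^ 2 - c ^ 2 - d ^ 2 - e ^ 2 = 0 →
      a ^ 2 * g 0 0 + b ^ 2 * g 1 1 + c ^ 2 * g 2 2 + d ^ 2 * g 3 3 + e ^ 2 * g 4 4
      + 2 * (a * b * g 0 1 + a * c * g 0 2 + a * d * g 0 3 + a * e * g 0 4 + b * c * g 1 2
      + b * d * g 1 3 + b * e * g 1 4 + c * d * g 2 3 + c * e * g 2 4 + d * e * g 3 4) = 0 := by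
    intro a b c d e h
    have := hnull ![a, b, c, d, e] (by rw [hs]; simpa using h)
    rw [hG] at this
    simp [Fin.sum_univ_five, hg 1 0, hg 2 0, hg 2 1, hg 3 0, hg 3 1, hg 3 2, hg 4 0, hg 4 1,
      hg 4 2, hg 4 3] at this
    linear_combination this
  have p02 := key 1 0 1 0 0 (by norm_num)
  have m02 := key 1 0 (-1) 0 0 (by norm_num)
  have p03 := key 1 0 0 1 0 (by norm_num)
  have m03 := key 1 0 0 (-1) 0 (by norm_num)
  have p04 := key 1 0 0 0 1 (by norm_num)
  have m04 := key 1 0 0 0 (-1) (by norm_num)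
  have p12 := key 0 1 1 0 0 (by norm_num)
  have m12 := key 0 1 (-1) 0 0 (by norm_num)
  have p13 := key 0 1 0 1 0 (by norm_num)
  have m13 := key 0 1 0 (-1) 0 (by norm_num)
  have p14 := key 0 1 0 0 1 (by norm_num)
  have m14 := key 0 1 0 0 (-1) (by norm_num)
  have p01 := key 3 4 5 0 0 (by norm_num)
  have p23 := key 5 0 3 4 0 (by norm_num)
  have p24 := key 5 0 3 0 4 (by norm_num)
  have p34 := key 5 0 0 3 4 (by norm_num)
  have g02 : g 0 2 = 0 := by linarith
  have g03 : g 0 3 = 0 := by linarith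
  have g04 : g 0 4 = 0 := by linarith
  have g12 : g 1 2 = 0 := by linarith
  have g13 : g 1 3 = 0 := by linarith
  have g14 : g 1 4 = 0 := by linarith
  have g22 : g 2 2 = -g 0 0 := by linarith
  have g33 : g 3 3 = -g 0 0 := by linarith
  have g44 : g 4 4 = -g 0 0 := by linarith
  have g11 : g 1 1 = g 0 0 := by linarith
  have g01 : g 0 1 = 0 := by linarith
  have g23 : g 2 3 = 0 := by linarith
  have g24 : g 2 4 = 0 := by linarith
  have g34 : g 3 4 = 0 := by linarith
  refine ⟨g 0 0, fun Z => ?_⟩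
  rw [hG, hs]
  simp [Fin.sum_univ_five, hg 1 0, hg 2 0, hg 2 1, hg 3 0, hg 3 1, hg 3 2, hg 4 0, hg 4 1,
      hg 4 2, hg 4 3, g01, g02, g03, g04, g12, g13, g14, g23, g24, g34, g11, g22, g33, g44]
  ring

/-- An injective map that is conformal from signature `(2,3)` to signature `(3,2)` has a negative
conformal factor. -/
theorem conformal_factor_neg (C : (Fin (2 + 3) → ℝ) →ₗ[ℝ] (Fin (3 + 2) → ℝ))
    (hC : Function.Injective C) (c : ℝ)
    (h : ∀ Z, sform 3 2 (C Z) (C Z) = c * sform 2 3 Z Z) : c < 0 := by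
  by_contra! hc
  let N : (Fin 3 → ℝ) →ₗ[ℝ] (Fin 5 → ℝ) := LinearMap.pi
    ![0, 0, LinearMap.proj 0, LinearMap.proj 1, LinearMap.proj 2]
  let D : (Fin 3 → ℝ) →ₗ[ℝ] (Fin 5 → ℝ) := C ∘ₗ N
  let p : (Fin 3 → ℝ) →ₗ[ℝ] (Fin 2 → ℝ) :=
    LinearMap.pi ![LinearMap.proj 3 ∘ₗ D, LinearMap.proj 4 ∘ₗ D]
  obtain ⟨x, hx, hx0⟩ := Submodule.exists_mem_ne_zero_of_ne_bot
    (LinearMap.ker_ne_bot_of_finrank_lt (f := p) (by simp))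
  have h3 : D x 3 = 0 := by simpa [p] using congrFun hx 0
  have h4 : D x 4 = 0 := by simpa [p] using congrFun hx 1
  have hq := h (N x)
  have e1 : sform 3 2 (C (N x)) (C (N x)) = D x 0 ^ 2 + D x 1 ^ 2 + D x 2 ^ 2 := by
    change (∑ i : Fin 5, (if (i : ℕ) < 3 then (1 : ℝ) else -1) * D x i * D x i) = _
    simp [Fin.sum_univ_five, h3, h4]
    ring
  have e2 : sform 2 3 (N x) (N x) = -(x 0 ^ 2 + x 1 ^ 2 + x 2 ^ 2) := by
    change (∑ i : Fin 5, (if (i : ℕ) < 2 then (1 : ℝ) else -1) * N x i * N x i) = _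
    simp [Fin.sum_univ_five, N]
    ring
  rw [e1, e2] at hq
  have hle : 0 ≤ c * (x 0 ^ 2 + x 1 ^ 2 + x 2 ^ 2) := by positivity
  have hD : D x = 0 := by
    funext i
    fin_cases i
    · change D x 0 = 0
      nlinarith [sq_nonneg (D x 0), sq_nonneg (D x 1), sq_nonneg (D x 2)]
    · change D x 1 = 0
      nlinarith [sq_nonneg (D x 0), sq_nonneg (D x 1), sq_nonneg (D x 2)]
    · change D x 2 = 0
      nlinarith [sq_nonneg (D x 0), sq_nonneg (D x 1), sq_nonneg (D x 2)]
    · exact h3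
    · exact h4
  have hN : N x = 0 := hC (by simpa [D] using hD)
  apply hx0
  funext i
  fin_cases i
  · exact congrFun hN 2
  · exact congrFun hN 3
  · exact congrFun hN 4

/-- A family of real `4 × 4` matrices whose squares are `-⟨Z,Z⟩_{2,3}`. -/
noncomputable def spinMatrix : (Fin (2 + 3) → ℝ) →ₗ[ℝ] Matrix (Fin 4) (Fin 4) ℝ where
  toFun Z := !![Z 3, 0, Z 2 + Z 1, Z 0 + Z 4;
                0, Z 3, Z 0 - Z 4, Z 2 - Z 1;
                Z 2 - Z 1, -Z 0 - Z 4, -Z 3, 0;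
                Z 4 - Z 0, Z 2 + Z 1, 0, -Z 3]
  map_add' Z W := by
    ext i j
    fin_cases i <;> fin_cases j <;> simp <;> ring
  map_smul' a Z := by
    ext i j
    fin_cases i <;> fin_cases j <;> simp <;> ring

theorem spinMatrix_mul_self (Z : Fin (2 + 3) → ℝ) :
    spinMatrix Z * spinMatrix Z = (-(sform 2 3 Z Z)) • 1 := by
  have hs : sform 2 3 Z Z = Z 0 ^ 2 + Z 1 ^ 2 - Z 2 ^ 2 - Z 3 ^ 2 - Z 4 ^ 2 := by
    change (∑ i : Fin 5, (if (i : ℕ) < 2 then (1 : ℝ) else -1) * Z i * Z i) = _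
    simp [Fin.sum_univ_five]
    ring
  rw [hs]
  ext i j
  fin_cases i <;> fin_cases j <;>
    simp [spinMatrix, Matrix.mul_apply, Fin.sum_univ_four] <;> ring

/-- The Clifford action on the double `ℝ⁴ × ℝ⁴` of the spin representation. -/
noncomputable def spinDouble :
    (Fin (2 + 3) → ℝ) →ₗ[ℝ] ((Fin 4 → ℝ) × (Fin 4 → ℝ)) →ₗ[ℝ] ((Fin 4 → ℝ) × (Fin 4 → ℝ)) :=
  LinearMap.mk₂ ℝ
    (fun Z v => ((spinMatrix Z).mulVec v.1, -(spinMatrix Z).transpose.mulVec v.2))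
    (fun Z W v => by ext <;> simp [Matrix.add_mulVec, add_comm])
    (fun a Z v => by simp [Matrix.smul_mulVec])
    (fun Z v w => by ext <;> simp [Matrix.mulVec_add, add_comm])
    (fun a Z v => by simp [Matrix.mulVec_smul])

/-- The neutral pairing of `ℝ⁴ × ℝ⁴`. -/
noncomputable def neutralForm :
    ((Fin 4 → ℝ) × (Fin 4 → ℝ)) →ₗ[ℝ] ((Fin 4 → ℝ) × (Fin 4 → ℝ)) →ₗ[ℝ] ℝ :=
  LinearMap.mk₂ ℝ (fun v w => v.1 ⬝ᵥ w.2 + v.2 ⬝ᵥ w.1)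
    (fun _ _ _ => by simp only [Prod.fst_add, Prod.snd_add, add_dotProduct]; ring)
    (fun _ _ _ => by simp only [Prod.smul_fst, Prod.smul_snd, smul_dotProduct, smul_add])
    (fun _ _ _ => by simp only [Prod.fst_add, Prod.snd_add, dotProduct_add]; ring)
    (fun _ _ _ => by simp only [Prod.smul_fst, Prod.smul_snd, dotProduct_smul, smul_add])

theorem isAdmissible_spinDouble : IsAdmissible 2 3 _ neutralForm spinDouble := by
  refine ⟨inferInstance, inferInstance, fun v w => ?_, fun v h => ?_, fun Z v => ?_,
    fun Z v w => ?_⟩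
  · simp only [neutralForm, LinearMap.mk₂_apply]
    rw [dotProduct_comm v.1, dotProduct_comm v.2, add_comm]
  · refine Prod.ext ?_ ?_
    · refine dotProduct_eq_zero _ fun w => ?_
      simpa [neutralForm] using h (0, w)
    · refine dotProduct_eq_zero _ fun w => ?_
      simpa [neutralForm] using h (w, 0)
  · refine Prod.ext ?_ ?_
    · simp [spinDouble, Matrix.mulVec_mulVec, spinMatrix_mul_self, Matrix.neg_mulVec,
        Matrix.smul_mulVec]
    · simp [spinDouble, Matrix.mulVec_neg, Matrix.mulVec_mulVec, ← Matrix.transpose_mul,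
        spinMatrix_mul_self, Matrix.neg_mulVec, Matrix.smul_mulVec]
  · simp only [neutralForm, spinDouble, LinearMap.mk₂_apply, Matrix.mulVec_transpose,
      dotProduct_neg, neg_dotProduct, Matrix.dotProduct_mulVec, neg_add_rev, neg_neg]
    rw [dotProduct_comm (Matrix.mulVec _ _), Matrix.dotProduct_mulVec,
      dotProduct_comm v.1, ← Matrix.dotProduct_mulVec]
    ring

/-- On a `Cl_{2,3}`-module of dimension at most `8`, no `B`-symmetric operator `S` satisfies
`S J_Z S = -κ J_Z` on basis vectors with `κ > 0`: it would act by a scalar `l` with `l² = -κ` on an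
eigenvector of `e 4` inside the joint fixed space of the involutions `e 0 e 2` and `e 1 e 3`. -/
theorem false_of_symmetric_intertwiner {V : Type*} [AddCommGroup V] [Module ℝ V]
    [FiniteDimensional ℝ V] [Nontrivial V] (hdim : Module.finrank ℝ V ≤ 8)
    (B : V →ₗ[ℝ] V →ₗ[ℝ] ℝ) (hsymm : ∀ v w, B v w = B w v)
    (hB : ∀ v : V, (∀ w : V, B v w = 0) → v = 0) (e : Fin 5 → V →ₗ[ℝ] V)
    (h0 : ∀ v, e 0 (e 0 v) = -v) (h1 : ∀ v, e 1 (e 1 v) = -v) (h2 : ∀ v, e 2 (e 2 v) = v)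
    (h3 : ∀ v, e 3 (e 3 v) = v) (h4 : ∀ v, e 4 (e 4 v) = v)
    (hanti : ∀ i j, i ≠ j → ∀ v, e i (e j v) = -e j (e i v))
    (hskew : ∀ i v w, B (e i v) w = -B v (e i w)) (S : V →ₗ[ℝ] V)
    (hS : ∀ v w, B (S v) w = B v (S w)) (κ : ℝ) (hκ : 0 < κ)
    (hSe : ∀ i v, S (e i (S v)) = (-κ) • e i v) : False := by
  have a10 := hanti 1 0 (by decide)
  have a20 := hanti 2 0 (by decide)
  have a21 := hanti 2 1 (by decide)
  have a30 := hanti 3 0 (by decide)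
  have a31 := hanti 3 1 (by decide)
  have a32 := hanti 3 2 (by decide)
  have a04 := hanti 0 4 (by decide)
  have a14 := hanti 1 4 (by decide)
  have a24 := hanti 2 4 (by decide)
  have a34 := hanti 3 4 (by decide)
  have hcomm : ∀ i j v, S (e i (e j v)) = e i (e j (S v)) := by
    intro i j v
    have h := hSe i (e j (S v))
    rw [hSe j v] at h
    simp only [map_smul] at h
    exact smul_right_injective V (neg_ne_zero.2 hκ.ne') h
  let E : Submodule ℝ V :=
    LinearMap.ker (e 0 ∘ₗ e 2 - LinearMap.id) ⊓ LinearMap.ker (e 1 ∘ₗ e 3 - LinearMap.id)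
  have hE : ∀ v, v ∈ E ↔ e 0 (e 2 v) = v ∧ e 1 (e 3 v) = v := fun v => by
    simp [E, sub_eq_zero]
  have hproj : ∀ v, v + e 0 (e 2 v) + e 1 (e 3 v) + e 0 (e 2 (e 1 (e 3 v))) ∈ E := fun v => by
    rw [hE]
    constructor <;>
    · simp only [map_add, map_neg, neg_neg, a10, a20, a21, a30, a31, a32, h0, h1, h2, h3]
      abel
  have hT0 : ∀ v, e 0 (e 1 v) = 0 → v = 0 := fun v hv => by
    simpa [h0, h1] using congrArg (fun u => e 1 (e 0 u)) hv
  have hdimE : Module.finrank ℝ E ≤ 2 := by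
    let L : E × E × E × E →ₗ[ℝ] V :=
      (E.subtype).coprod ((e 0 ∘ₗ e 4 ∘ₗ E.subtype).coprod
        ((e 1 ∘ₗ e 4 ∘ₗ E.subtype).coprod (e 0 ∘ₗ e 1 ∘ₗ E.subtype)))
    have hL : Function.Injective L := by
      rw [← LinearMap.ker_eq_bot, LinearMap.ker_eq_bot']
      rintro ⟨⟨a, ha⟩, ⟨b, hb⟩, ⟨c, hc⟩, ⟨d, hd⟩⟩ h
      rw [hE] at ha hb hc hd
      have e1 : a + (e 0 (e 4 b) + (e 1 (e 4 c) + e 0 (e 1 d))) = 0 := by simpa [L] using h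
      have sP : ∀ v, e 0 (e 2 v) = v → e 2 v = -e 0 v := fun v hv => by
        have h' := congrArg (e 0) hv
        rw [h0] at h'
        rw [← h', neg_neg]
      have sQ : ∀ v, e 1 (e 3 v) = v → e 3 v = -e 1 v := fun v hv => by
        have h' := congrArg (e 1) hv
        rw [h1] at h'
        rw [← h', neg_neg]
      have e2 := congrArg (fun v => e 0 (e 2 v)) e1
      have e3 := congrArg (fun v => e 1 (e 3 v)) e1
      have e4 := congrArg (fun v => e 1 (e 3 v)) e2
      simp only [map_add, map_neg, map_zero, neg_neg, a10, a20, a21, a30, a31, a04, a14, a24, a34,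
        h0, h1, sP _ ha.1, sP _ hb.1, sP _ hc.1, sP _ hd.1, sQ _ ha.2, sQ _ hb.2, sQ _ hc.2,
        sQ _ hd.2] at e1 e2 e3 e4
      have za : a = 0 := by
        linear_combination (norm := module) (1 / 4 : ℝ) • (e1 + e2 + e3 + e4)
      have zb : e 4 (e 0 b) = 0 := by
        linear_combination (norm := module) (-1 / 4 : ℝ) • (e1 - e2 + e3 - e4)
      have zc : e 4 (e 1 c) = 0 := by
        linear_combination (norm := module) (-1 / 4 : ℝ) • (e1 + e2 - e3 - e4)
      have zd : e 0 (e 1 d) = 0 := by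
        linear_combination (norm := module) (1 / 4 : ℝ) • (e1 - e2 - e3 + e4)
      have zb' : b = 0 := by
        rw [← neg_eq_zero, ← h0, ← h4 (e 0 b), zb, map_zero, map_zero]
      have zc' : c = 0 := by
        rw [← neg_eq_zero, ← h1, ← h4 (e 1 c), zc, map_zero, map_zero]
      have zd' : d = 0 := hT0 d zd
      simp [za, zb', zc', zd']
    have := LinearMap.finrank_le_finrank_of_injective hL
    simp only [Module.finrank_prod] at this
    omega
  have hSE : ∀ v ∈ E, S v ∈ E := fun v hv => by
    rw [hE] at hv ⊢
    rw [← hcomm, ← hcomm, hv.1, hv.2]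
    exact ⟨rfl, rfl⟩
  have h4E : ∀ v ∈ E, e 4 v ∈ E := fun v hv => by
    rw [hE] at hv ⊢
    simp only [a04, a14, a24, a34, map_neg, neg_neg, hv.1, hv.2, and_self]
  have hne : ∃ v ∈ E, v ≠ 0 := by
    by_contra! hzero
    have hQ : ∀ v, v + e 1 (e 3 v) = 0 := fun v => by
      have p := hzero _ (hproj v)
      have q := congrArg (fun v => e 4 (e 0 v)) (hzero _ (hproj (e 4 (e 0 v))))
      simp only [map_add, map_neg, map_zero, neg_neg, a10, a20, a21, a30, a04, a14, a24, a34, h0,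
        h4] at p q
      linear_combination (norm := module) (1 / 2 : ℝ) • (p + q)
    obtain ⟨v, hv⟩ := exists_ne (0 : V)
    have p := hQ v
    have q := congrArg (fun v => e 4 (e 1 v)) (hQ (e 4 (e 1 v)))
    simp only [map_add, map_neg, map_zero, neg_neg, a31, a14, a34, h1, h4] at p q
    apply hv
    linear_combination (norm := module) (1 / 2 : ℝ) • (p + q)
  obtain ⟨x, hx, hx0, σ, hσ, hxσ⟩ : ∃ x ∈ E, x ≠ 0 ∧ ∃ σ : ℝ, σ ≠ 0 ∧ e 4 x = σ • x := by
    obtain ⟨v, hv, hv0⟩ := hne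
    by_cases h : v + e 4 v = 0
    · exact ⟨v, hv, hv0, -1, by norm_num, by
        rw [neg_one_smul]; exact (neg_eq_of_add_eq_zero_right h).symm⟩
    · exact ⟨v + e 4 v, E.add_mem hv (h4E v hv), h, 1, one_ne_zero, by
        rw [map_add, h4, one_smul, add_comm]⟩
  let φ : E →ₗ[ℝ] ℝ := B (e 0 (e 1 x)) ∘ₗ E.subtype
  have halt : ∀ v w, B (e 0 (e 1 v)) w = -B (e 0 (e 1 w)) v := fun v w => by
    rw [hskew, hskew, neg_neg, hsymm, a10, map_neg, LinearMap.neg_apply]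
  have hφx : φ ⟨x, hx⟩ = 0 := self_eq_neg.1 (halt x x)
  have hφS : φ ⟨S x, hSE x hx⟩ = 0 := by
    have h := halt x (S x)
    rw [← hcomm, hS] at h
    exact self_eq_neg.1 h
  have hφ : LinearMap.range φ = ⊤ := by
    rw [LinearMap.range_eq_top]
    refine LinearMap.surjective fun h => hx0 ?_
    have hT : e 0 (e 1 x) = 0 := hB _ fun w => by
      have hw := LinearMap.congr_fun h ⟨_, hproj w⟩
      obtain ⟨hP, hQ⟩ := (hE x).1 hx
      have eP : ∀ u, B (e 0 (e 1 x)) (e 0 (e 2 u)) = B (e 0 (e 1 x)) u := fun u => by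
        conv_rhs => rw [← hP]
        rw [← neg_neg (B _ (e 0 (e 2 u))), ← hskew, ← neg_eq_iff_eq_neg.2 (hskew 2 _ u)]
        simp [a10, a21, h0]
      have eQ : ∀ u, B (e 0 (e 1 x)) (e 1 (e 3 u)) = B (e 0 (e 1 x)) u := fun u => by
        conv_rhs => rw [← hQ]
        rw [← neg_neg (B _ (e 1 (e 3 u))), ← hskew, ← neg_eq_iff_eq_neg.2 (hskew 3 _ u)]
        simp [a10, a30, h1]
      simp only [φ, LinearMap.comp_apply, Submodule.subtype_apply, map_add, eP, eQ,
        LinearMap.zero_apply] at hw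
      linarith
    exact hT0 x hT
  have hker : Module.finrank ℝ (LinearMap.ker φ) = 1 := by
    have h := LinearMap.finrank_range_add_finrank_ker φ
    rw [hφ, finrank_top, Module.finrank_self] at h
    have hpos : 0 < Module.finrank ℝ (LinearMap.ker φ) :=
      Module.finrank_pos_iff_exists_ne_zero.2
        ⟨⟨⟨x, hx⟩, hφx⟩, fun h => hx0 (congrArg (fun v : LinearMap.ker φ => ((v : E) : V)) h)⟩
    omega
  obtain ⟨l, hl⟩ := exists_smul_eq_of_finrank_eq_one hker
    (x := ⟨⟨x, hx⟩, hφx⟩) (fun h => hx0 (congrArg (fun v : LinearMap.ker φ => ((v : E) : V)) h))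
    ⟨⟨S x, hSE x hx⟩, hφS⟩
  have hlS : S x = l • x := (congrArg (fun v : LinearMap.ker φ => ((v : E) : V)) hl).symm
  have hfin := hSe 4 x
  simp only [hlS, map_smul, hxσ, smul_smul] at hfin
  have hcoef : l * σ * l = -κ * σ := smul_left_injective ℝ hx0 hfin
  have : (l ^ 2 + κ) * σ = 0 := by linear_combination hcoef
  rcases mul_eq_zero.1 this with h | h
  · nlinarith [sq_nonneg l]
  · exact hσ h

theorem stmt14
    (V1 : Type) [AddCommGroup V1] [Module ℝ V1]
    (B1 : V1 →ₗ[ℝ] V1 →ₗ[ℝ] ℝ)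
    (J1 : (Fin (3 + 2) → ℝ) →ₗ[ℝ] V1 →ₗ[ℝ] V1)
    (br1 : V1 →ₗ[ℝ] V1 →ₗ[ℝ] (Fin (3 + 2) → ℝ))
    (hadm1 : IsMinimalAdmissible 3 2 V1 B1 J1)
    (hbr1 : IsHBracket 3 2 V1 B1 J1 br1)
    (V2 : Type) [AddCommGroup V2] [Module ℝ V2]
    (B2 : V2 →ₗ[ℝ] V2 →ₗ[ℝ] ℝ)
    (J2 : (Fin (2 + 3) → ℝ) →ₗ[ℝ] V2 →ₗ[ℝ] V2)
    (br2 : V2 →ₗ[ℝ] V2 →ₗ[ℝ] (Fin (2 + 3) → ℝ))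
    (hadm2 : IsMinimalAdmissible 2 3 V2 B2 J2)
    (hbr2 : IsHBracket 2 3 V2 B2 J2 br2)
    :
    ¬ ∃ f : (V1 × (Fin (3 + 2) → ℝ)) ≃ₗ[ℝ] (V2 × (Fin (2 + 3) → ℝ)),
      IsLieIso br1 br2 f := by
  rintro ⟨f, hf⟩
  obtain ⟨h1, -⟩ := hadm1
  obtain ⟨h2, hmin⟩ := hadm2
  have hdim : Module.finrank ℝ V2 ≤ 8 := by
    simpa [Module.finrank_prod] using hmin _ _ _ isAdmissible_spinDouble
  have hf1 := hf.map_center h1 hbr1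
  have hf2 := hf.symm.map_center h2 hbr2
  let A : V1 →ₗ[ℝ] V2 := LinearMap.fst ℝ _ _ ∘ₗ f.toLinearMap ∘ₗ LinearMap.inl ℝ _ _
  let C : (Fin (3 + 2) → ℝ) →ₗ[ℝ] (Fin (2 + 3) → ℝ) :=
    LinearMap.snd ℝ _ _ ∘ₗ f.toLinearMap ∘ₗ LinearMap.inr ℝ _ _
  have hCbr : ∀ x y, C (br1 x y) = br2 (A x) (A y) := fun x y =>
    congrArg Prod.snd (hf (x, 0) (y, 0))
  have hA : Function.Surjective A := fun u => by
    refine ⟨(f.symm (u, 0)).1, ?_⟩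
    have hsplit : ((f.symm (u, 0)).1, (0 : Fin (3 + 2) → ℝ))
        = f.symm (u, 0) - (0, (f.symm (u, 0)).2) := by ext <;> simp
    change (f ((f.symm (u, 0)).1, 0)).1 = u
    rw [hsplit, map_sub, Prod.fst_sub, hf1, f.apply_symm_apply, sub_zero]
  have hC : Function.Surjective C := fun z => by
    refine ⟨(f.symm (0, z)).2, ?_⟩
    have hsplit : ((0 : V1), (f.symm (0, z)).2) = f.symm (0, z) := Prod.ext (hf2 z).symm rfl
    change (f (0, (f.symm (0, z)).2)).2 = z
    rw [hsplit, f.apply_symm_apply]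
  obtain ⟨C', hC'⟩ := exists_adjoint (sformBilin 3 2) (sform_nondegenerate 3 2)
    (sformBilin 2 3) C
  have hfin1 : FiniteDimensional ℝ V1 := h1.1
  obtain ⟨A', hA'⟩ := exists_adjoint B1 h1.2.2.2.1 B2 A
  have hC'inj : Function.Injective C' := by
    rw [← LinearMap.ker_eq_bot, LinearMap.ker_eq_bot']
    intro Z hZ
    refine sform_nondegenerate 2 3 Z fun W => ?_
    obtain ⟨w, rfl⟩ := hC W
    rw [← sformBilin_apply, hC', hZ, map_zero, LinearMap.zero_apply]
  have hAJ : ∀ Z x, A' (J2 Z (A x)) = J1 (C' Z) x := fun Z x => by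
    rw [← sub_eq_zero]
    refine h1.2.2.2.1 _ fun y => ?_
    rw [map_sub, LinearMap.sub_apply, ← hA', ← hbr2, ← hbr1, ← hCbr, sub_eq_zero]
    exact hC' Z _
  have hJ1 := h1.2.2.2.2.1
  obtain ⟨-, hV2, hsymm, hnd, hJ2, hskew⟩ := id h2
  have : FiniteDimensional ℝ V2 := h2.1
  obtain ⟨c, hc⟩ := exists_eq_mul_sform ((sformBilin 3 2).compl₁₂ C' C')
    (fun Z W => sform_comm 3 2 _ _) fun Z hZ => by
      obtain ⟨u, hu0, hu⟩ : ∃ u, u ≠ 0 ∧ J2 Z u = 0 := by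
        obtain ⟨v, hv⟩ := exists_ne (0 : V2)
        by_cases h : J2 Z v = 0
        · exact ⟨v, hv, h⟩
        · exact ⟨J2 Z v, h, by rw [hJ2, hZ, neg_zero, zero_smul]⟩
      obtain ⟨x, rfl⟩ := hA u
      have hx : x ≠ 0 := fun h => hu0 (by rw [h, map_zero])
      have h := hJ1 (C' Z) x
      rw [← hAJ Z x, hu, map_zero, map_zero] at h
      rw [neg_smul, zero_eq_neg] at h
      exact (smul_eq_zero.1 h).resolve_right hx
  have hc0 : c < 0 := conformal_factor_neg C' hC'inj c hc
  have hconj : ∀ Z, sform 2 3 Z Z ≠ 0 → ∀ v, A (A' (J2 Z (A (A' v)))) = c • J2 Z v := by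
    intro Z hZ v
    obtain ⟨x, hx⟩ := hA (J2 Z v)
    have h := hJ1 (C' Z) x
    rw [← hAJ Z x, ← hAJ, hx, hJ2] at h
    have hq : sform 3 2 (C' Z) (C' Z) = c * sform 2 3 Z Z := hc Z
    have h' := congrArg A h
    simp only [map_smul, hx, hq] at h'
    refine smul_right_injective V2 (neg_ne_zero.2 hZ) ?_
    simp only [h', smul_smul]
    congr 1
    ring
  have hs : ∀ i j : Fin 5, sform 2 3 (Pi.single i 1) (Pi.single j 1)
      = if i = j then (if (i : ℕ) < 2 then 1 else -1) else 0 := fun i j => by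
    change (∑ k : Fin 5, (if (k : ℕ) < 2 then (1 : ℝ) else -1) * (Pi.single i 1 : Fin 5 → ℝ) k
      * (Pi.single j 1 : Fin 5 → ℝ) k) = _
    by_cases hij : i = j
    · simp [hij, Pi.single_apply]
    · simp [hij, Ne.symm hij, Pi.single_apply]
  refine false_of_symmetric_intertwiner hdim B2 hsymm hnd
    (fun i : Fin 5 => J2 (Pi.single i 1)) (fun v => ?_) (fun v => ?_) (fun v => ?_) (fun v => ?_)
    (fun v => ?_) (fun i j hij v => ?_) (fun i v w => hskew _ v w) (A ∘ₗ A') (fun v w => ?_) (-c)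
    (neg_pos.2 hc0) (fun i v => ?_)
  iterate 5
    rw [hJ2, hs]
    simp
  · have h := h2.clifford_polar (Pi.single i 1) (Pi.single j 1) v
    rw [hs, if_neg hij] at h
    simpa [add_eq_zero_iff_eq_neg] using h
  · simp only [LinearMap.comp_apply]
    rw [hA', hsymm, hA', h1.2.2.1]
  · rw [neg_neg]
    refine hconj _ ?_ v
    rw [hs, if_pos rfl]
    split_ifs <;> norm_num
end

section
/- Every pseudo H-type Lie algebra of signature (r,0) with r ≥ 1 and every pseudo H-type Lie algebra of signature (0,s) with s ≥ 1 (built on any admissible module) has the strongly bracket generating property: for every nonzero v ∈ V, the linear map ad_v = [v,·] : V → ℝ^{r+s} is surjective. -/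
/-- The scalar product `⟨·,·⟩_{r,s}` represents every linear functional on `ℝ^{r+s}`. -/
theorem exists_sform_eq (r s : ℕ) (f : (Fin (r + s) → ℝ) →ₗ[ℝ] ℝ) :
    ∃ Z, ∀ W, sform r s Z W = f W := by
  refine ⟨fun i => (if (i : ℕ) < r then (1 : ℝ) else -1) * f (Pi.single i 1), fun W => ?_⟩
  rw [LinearMap.pi_apply_eq_sum_univ f W, sform]
  refine Finset.sum_congr rfl fun i _ => ?_
  have hi : (fun j => if i = j then (1 : ℝ) else 0) = Pi.single i 1 := by
    ext j
    simp [Pi.single_apply, eq_comm]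
  rw [hi, smul_eq_mul]
  split_ifs <;> ring

theorem eq_zero_of_sform_self_left {r : ℕ} {Z : Fin (r + 0) → ℝ} (h : sform r 0 Z Z = 0) :
    Z = 0 := by
  have hsum : ∑ i, Z i * Z i = 0 := by
    refine Eq.trans ?_ h
    rw [sform]
    refine Finset.sum_congr rfl fun i _ => ?_
    rw [if_pos (by simp), one_mul]
  ext i
  simpa using (Finset.sum_eq_zero_iff_of_nonneg fun i _ => mul_self_nonneg (Z i)).mp hsum i
    (Finset.mem_univ i)

theorem eq_zero_of_sform_self_right {s : ℕ} {Z : Fin (0 + s) → ℝ} (h : sform 0 s Z Z = 0) :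
    Z = 0 := by
  have hsum : ∑ i, Z i * Z i = 0 := by
    rw [← neg_eq_zero]
    refine Eq.trans ?_ h
    rw [sform, ← Finset.sum_neg_distrib]
    refine Finset.sum_congr rfl fun i _ => ?_
    rw [if_neg (Nat.not_lt_zero _)]
    ring
  ext i
  simpa using (Finset.sum_eq_zero_iff_of_nonneg fun i _ => mul_self_nonneg (Z i)).mp hsum i
    (Finset.mem_univ i)

/-- If `⟨·,·⟩_{r,s}` is anisotropic, every pseudo `H`-type Lie algebra of signature `(r,s)` has
the strongly bracket generating property. -/
theorem IsHBracket.surjective_of_anisotropic {r s : ℕ} {V : Type} [AddCommGroup V] [Module ℝ V]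
    {B : V →ₗ[ℝ] V →ₗ[ℝ] ℝ} {J : (Fin (r + s) → ℝ) →ₗ[ℝ] V →ₗ[ℝ] V}
    {br : V →ₗ[ℝ] V →ₗ[ℝ] (Fin (r + s) → ℝ)} (hbr : IsHBracket r s V B J br)
    (hadm : IsAdmissible r s V B J)
    (haniso : ∀ Z : Fin (r + s) → ℝ, sform r s Z Z = 0 → Z = 0) {v : V} (hv : v ≠ 0) :
    Function.Surjective (br v) := by
  obtain ⟨-, -, -, hnondeg, hsq, -⟩ := hadm
  rw [← LinearMap.range_eq_top]
  by_contra hne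
  obtain ⟨f, hf, hle⟩ := Submodule.exists_le_ker_of_lt_top _ (lt_top_iff_ne_top.mpr hne)
  obtain ⟨Z, hZ⟩ := exists_sform_eq r s f
  have hJ : J Z v = 0 := hnondeg _ fun w => by
    rw [← hbr Z v w, hZ]
    exact hle (LinearMap.mem_range_self _ w)
  have hZZ : sform r s Z Z = 0 := by
    have h := hsq Z v
    rw [hJ, map_zero, eq_comm, smul_eq_zero, neg_eq_zero] at h
    exact h.resolve_right hv
  apply hf
  refine LinearMap.ext fun W => ?_
  simp [← hZ, haniso Z hZZ, sform]

theorem stmt17 :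
    (∀ r : ℕ, 1 ≤ r →
      ∀ (V : Type) [AddCommGroup V] [Module ℝ V]
        (B : V →ₗ[ℝ] V →ₗ[ℝ] ℝ)
        (J : (Fin (r + 0) → ℝ) →ₗ[ℝ] V →ₗ[ℝ] V)
        (br : V →ₗ[ℝ] V →ₗ[ℝ] (Fin (r + 0) → ℝ)),
        IsAdmissible r 0 V B J → IsHBracket r 0 V B J br →
        ∀ v : V, v ≠ 0 → Function.Surjective ⇑(br v)) ∧
    (∀ s : ℕ, 1 ≤ s →
      ∀ (V : Type) [AddCommGroup V] [Module ℝ V]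
        (B : V →ₗ[ℝ] V →ₗ[ℝ] ℝ)
        (J : (Fin (0 + s) → ℝ) →ₗ[ℝ] V →ₗ[ℝ] V)
        (br : V →ₗ[ℝ] V →ₗ[ℝ] (Fin (0 + s) → ℝ)),
        IsAdmissible 0 s V B J → IsHBracket 0 s V B J br →
        ∀ v : V, v ≠ 0 → Function.Surjective ⇑(br v)) := by
  exact ⟨fun _ _ _ _ _ _ _ _ hadm hbr _ hv =>
      hbr.surjective_of_anisotropic hadm (fun _ => eq_zero_of_sform_self_left) hv,
    fun _ _ _ _ _ _ _ _ hadm hbr _ hv =>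
      hbr.surjective_of_anisotropic hadm (fun _ => eq_zero_of_sform_self_right) hv⟩
end

section
/- For all r,s ≥ 1, no pseudo H-type Lie algebra of signature (r,s) (built on any admissible module) has the strongly bracket generating property: there exists a nonzero v ∈ V such that ad_v = [v,·] : V → ℝ^{r+s} is not surjective. -/
theorem sform_single_right (r s : ℕ) (Z : Fin (r + s) → ℝ) (i : Fin (r + s)) :
    sform r s Z (Pi.single i 1) = (if (i : ℕ) < r then (1 : ℝ) else -1) * Z i := by
  simp [sform, Pi.single_apply]

theorem sform_add_right (r s : ℕ) (Z W₁ W₂ : Fin (r + s) → ℝ) :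
    sform r s Z (W₁ + W₂) = sform r s Z W₁ + sform r s Z W₂ := by
  simp [sform, mul_add, Finset.sum_add_distrib]

/-- In mixed signature there is an isotropic vector which is not orthogonal to every vector. -/
theorem exists_sform_self_eq_zero {r s : ℕ} (hr : 1 ≤ r) (hs : 1 ≤ s) :
    ∃ Z W : Fin (r + s) → ℝ, sform r s Z Z = 0 ∧ sform r s Z W ≠ 0 := by
  let i : Fin (r + s) := ⟨0, by omega⟩
  let j : Fin (r + s) := ⟨r, by omega⟩
  have hij : i ≠ j := fun h => by
    have := congrArg Fin.val h
    simp only [i, j] at this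
    omega
  have hi : (i : ℕ) < r := hr
  have hj : ¬ (j : ℕ) < r := lt_irrefl r
  refine ⟨Pi.single i 1 + Pi.single j 1, Pi.single i 1, ?_, ?_⟩
  · rw [sform_add_right, sform_single_right, sform_single_right, if_pos hi, if_neg hj]
    simp [hij, hij.symm]
  · rw [sform_single_right, if_pos hi]
    simp [hij]

/-- A square-zero endomorphism of a nontrivial module kills some nonzero vector. -/
theorem exists_ne_zero_map_eq_zero {V : Type*} [AddCommGroup V] [Module ℝ V] [Nontrivial V]
    (f : V →ₗ[ℝ] V) (hf : ∀ v, f (f v) = 0) : ∃ v, v ≠ 0 ∧ f v = 0 := by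
  obtain ⟨u, hu⟩ := exists_ne (0 : V)
  by_cases h : f u = 0
  · exact ⟨u, hu, h⟩
  · exact ⟨f u, h, hf u⟩

theorem stmt18 (r s : ℕ) (hr : 1 ≤ r) (hs : 1 ≤ s)
    (V1 : Type) [AddCommGroup V1] [Module ℝ V1]
    (B1 : V1 →ₗ[ℝ] V1 →ₗ[ℝ] ℝ)
    (J1 : (Fin (r + s) → ℝ) →ₗ[ℝ] V1 →ₗ[ℝ] V1)
    (br1 : V1 →ₗ[ℝ] V1 →ₗ[ℝ] (Fin (r + s) → ℝ))
    (hadm1 : IsAdmissible r s V1 B1 J1)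
    (hbr1 : IsHBracket r s V1 B1 J1 br1)
    :
    ∃ v : V1, v ≠ 0 ∧ ¬ Function.Surjective ⇑(br1 v) := by
  obtain ⟨-, hV, -, -, hsq, -⟩ := hadm1
  obtain ⟨Z, W, hZ, hW⟩ := exists_sform_self_eq_zero hr hs
  obtain ⟨v, hv, hJv⟩ := exists_ne_zero_map_eq_zero (J1 Z) fun v => by simp [hsq, hZ]
  refine ⟨v, hv, fun hsurj => hW ?_⟩
  obtain ⟨w, rfl⟩ := hsurj W
  simp [hbr1 Z v w, hJv]
end

section
/- Let V and z be finite-dimensional real vector spaces equipped with nondegenerate symmetric bilinear forms ⟨·,·⟩_V and ⟨·,·⟩_z, let [·,·] : V × V → z be a skew-symmetric bilinear map, and define J : z → End(V) by ⟨J_Z v, w⟩_V = ⟨Z, [v,w]⟩_z for all Z ∈ z, v,w ∈ V. Then the following are equivalent: (i) ⟨J_Z v, J_Z v⟩_V = ⟨Z,Z⟩_z · ⟨v,v⟩_V for all Z ∈ z and v ∈ V (pseudo H-type condition); (ii) for every v ∈ V with ⟨v,v⟩_V = 1 or ⟨v,v⟩_V = −1, the restriction of ⟨·,·⟩_V to ker(ad_v)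 is nondegenerate and, denoting by 𝔙_v the orthogonal complement of ker(ad_v) in V, the restriction ad_v : 𝔙_v → z is a bijection onto z which is an isometry when ⟨v,v⟩_V = 1 and an anti-isometry when ⟨v,v⟩_V = −1, i.e. ⟨[v,w], [v,w']⟩_z = ⟨v,v⟩_V · ⟨w,w'⟩_V for all w,w' ∈ 𝔙_v (general H-type condition). -/
/-- If `Q v v = c * B v v` holds on the unit vectors `B v v = ±1` of a nondegenerate symmetric
bilinear form `B`, then it holds for every `v`. -/
theorem bilin_self_eq_of_eq_on_unit {V : Type*} [AddCommGroup V] [Module ℝ V]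
    (B Q : V →ₗ[ℝ] V →ₗ[ℝ] ℝ) (c : ℝ)
    (hsymm : ∀ v w : V, B v w = B w v)
    (hnd : ∀ v : V, (∀ w : V, B v w = 0) → v = 0)
    (h : ∀ v : V, (B v v = 1 ∨ B v v = -1) → Q v v = c * B v v) (v : V) :
    Q v v = c * B v v := by
  have nonnull : ∀ v : V, B v v ≠ 0 → Q v v = c * B v v := by
    intro v hv
    have hpos : 0 < |B v v| := abs_pos.mpr hv
    set s := Real.sqrt |B v v| with hs
    have hs0 : s ≠ 0 := (Real.sqrt_pos.mpr hpos).ne'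
    have hss : s * s = |B v v| := Real.mul_self_sqrt hpos.le
    have hunit : B (s⁻¹ • v) (s⁻¹ • v) = B v v / |B v v| := by
      simp only [map_smul, LinearMap.smul_apply, smul_eq_mul]
      rw [← hss]
      field_simp
    have key := h (s⁻¹ • v) (by
      rw [hunit]
      rcases lt_or_gt_of_ne hv with hneg | hpos'
      · right
        rw [abs_of_neg hneg, div_neg, div_self hv]
      · left
        rw [abs_of_pos hpos', div_self hv])
    simp only [map_smul, LinearMap.smul_apply, smul_eq_mul] at key
    field_simp at key
    exact key
  by_cases hv : B v v = 0
  · by_cases hv0 : v = 0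
    · simp [hv0]
    obtain ⟨w, hw⟩ : ∃ w, B v w ≠ 0 := by
      by_contra! hcon
      exact hv0 (hnd v hcon)
    obtain ⟨u, hvu, huu⟩ : ∃ u, B v u ≠ 0 ∧ B u u = 0 := by
      refine ⟨w - (B w w / (2 * B v w)) • v, ?_, ?_⟩
      · simpa [hv] using hw
      · simp only [map_sub, map_smul, LinearMap.sub_apply, LinearMap.smul_apply, smul_eq_mul, hv,
          hsymm w v]
        field_simp
        ring
    have along : ∀ t : ℝ, t ≠ 0 →
        Q v v + t * (Q v u + Q u v) + t ^ 2 * Q u u = c * (2 * t * B v u) := by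
      intro t ht
      have hB : B (v + t • u) (v + t • u) = 2 * t * B v u := by
        simp only [map_add, map_smul, LinearMap.add_apply, LinearMap.smul_apply, smul_eq_mul, hv,
          huu, hsymm u v]
        ring
      have key := nonnull (v + t • u) (by
        rw [hB]
        exact mul_ne_zero (mul_ne_zero two_ne_zero ht) hvu)
      rw [hB] at key
      rw [← key]
      simp only [map_add, map_smul, LinearMap.add_apply, LinearMap.smul_apply, smul_eq_mul]
      ring
    have h1 := along 1 one_ne_zero
    have h2 := along (-1) (by norm_num)
    have h3 := along 2 two_ne_zero
    rw [hv]
    linarith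
  · exact nonnull v hv


theorem stmt19 (V z : Type) [AddCommGroup V] [Module ℝ V]
    [AddCommGroup z] [Module ℝ z]
    [FiniteDimensional ℝ V] [FiniteDimensional ℝ z]
    (BV : V →ₗ[ℝ] V →ₗ[ℝ] ℝ) (Bz : z →ₗ[ℝ] z →ₗ[ℝ] ℝ)
    (hVsymm : ∀ v w : V, BV v w = BV w v)
    (hVnd : ∀ v : V, (∀ w : V, BV v w = 0) → v = 0)
    (hzsymm : ∀ Z W : z, Bz Z W = Bz W Z)
    (hznd : ∀ Z : z, (∀ W : z, Bz Z W = 0) → Z = 0)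
    (br : V →ₗ[ℝ] V →ₗ[ℝ] z)
    (hskew : ∀ v w : V, br v w = -(br w v))
    (J : z →ₗ[ℝ] V →ₗ[ℝ] V)
    (hJ : ∀ (Z : z) (v w : V), BV (J Z v) w = Bz Z (br v w)) :
    (∀ (Z : z) (v : V), BV (J Z v) (J Z v) = Bz Z Z * BV v v) ↔
    (∀ v : V, (BV v v = 1 ∨ BV v v = -1) →
      (∀ w : V, br v w = 0 → (∀ w' : V, br v w' = 0 → BV w w' = 0) → w = 0) ∧
      Function.Bijective
        (fun u : {u : V // ∀ w : V, br v w = 0 → BV u w = 0} => br v u.1) ∧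
      (∀ w w' : V, (∀ x : V, br v x = 0 → BV w x = 0) →
        (∀ x : V, br v x = 0 → BV w' x = 0) →
        Bz (br v w) (br v w') = BV v v * BV w w')) := by
  constructor
  · intro h v hv
    have hsq : BV v v * BV v v = 1 := by
      rcases hv with hv | hv <;> rw [hv] <;> norm_num
    have polar : ∀ Z W : z, BV (J Z v) (J W v) = BV v v * Bz Z W := by
      intro Z W
      have h1 := h (Z + W) v
      simp only [map_add, LinearMap.add_apply] at h1
      have h2 := h Z v
      have h3 := h W v
      rw [hVsymm (J W v) (J Z v), hzsymm W Z] at h1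
      linarith
    have brJ : ∀ W : z, br v (J W v) = BV v v • W := by
      intro W
      refine sub_eq_zero.mp (hznd _ fun Z => ?_)
      rw [hzsymm, map_sub, ← hJ, polar, map_smul, smul_eq_mul, sub_self]
    have hker : ∀ x : V, br v (x - BV v v • J (br v x) v) = 0 := by
      intro x
      rw [map_sub, map_smul, brJ, smul_smul, hsq, one_smul, sub_self]
    have hnd : ∀ w : V, br v w = 0 → (∀ w' : V, br v w' = 0 → BV w w' = 0) → w = 0 := by
      intro w hw hperp
      refine hVnd w fun x => ?_
      have h1 := hperp _ (hker x)
      rw [map_sub, map_smul, hVsymm w (J _ v), hJ, hw, map_zero, smul_zero, sub_zero] at h1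
      exact h1
    refine ⟨hnd, ⟨?_, ?_⟩, ?_⟩
    · rintro ⟨a, ha⟩ ⟨b, hb⟩ hab
      refine Subtype.ext (sub_eq_zero.mp (hnd (a - b) ?_ fun x hx => ?_))
      · rw [map_sub]
        exact sub_eq_zero.mpr hab
      · rw [map_sub, LinearMap.sub_apply, ha x hx, hb x hx, sub_self]
    · intro Z
      refine ⟨⟨BV v v • J Z v, fun w hw => ?_⟩, ?_⟩
      · rw [map_smul, LinearMap.smul_apply, hJ, hw, map_zero, smul_zero]
      · change br v (BV v v • J Z v) = Z
        rw [map_smul, brJ, smul_smul, hsq, one_smul]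
    · intro w w' hw _
      have h1 := hw _ (hker w')
      rw [map_sub, map_smul, hVsymm w (J _ v), hJ, smul_eq_mul, sub_eq_zero] at h1
      rw [h1, ← mul_assoc, hsq, one_mul, hzsymm]
  · intro h Z v
    refine bilin_self_eq_of_eq_on_unit BV (BV.compl₁₂ (J Z) (J Z)) (Bz Z Z) hVsymm hVnd ?_ v
    intro v hv
    obtain ⟨-, ⟨-, hsurj⟩, hiso⟩ := h v hv
    obtain ⟨⟨u, hu⟩, huZ⟩ := hsurj Z
    change br v u = Z at huZ
    have hJperp : ∀ x : V, br v x = 0 → BV (J Z v) x = 0 := by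
      intro x hx
      rw [hJ, hx, map_zero]
    have h1 := hiso u (J Z v) hu hJperp
    rw [huZ, ← hJ, hVsymm u, hJ Z v u, huZ] at h1
    rw [LinearMap.compl₁₂_apply, h1, mul_comm]
end
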